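/- arXiv:2502.16904 — 4 statements merged into one kernel-verified Lean document; each statement's English description precedes it below -/
import Mathlib

section
/- Let β > -1/2. There exists a constant C > 0 (depending only on β) such that for every continuously differentiable function u : (0,1] → ℝ with (∫₀¹ s^{2β}|u(s)|² ds)^{1/2} and (∫₀¹ s^{2(β+1)}|u'(s)|² ds)^{1/2} finite, one has sup_{0<s<1} s^{β+1/2}|u(s)| ≤ C ( (∫₀¹ s^{2β}|u(s)|² ds)^{1/2} + (∫₀¹ s^{2(β+1)}|u'(s)|² ds)^{1/2} ). -/
open MeasureTheory ENNReal RealInnerProductSpace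

noncomputable section

/-- The weighted L² norm `‖s^α v‖_{L²(0,1)} = (∫₀¹ s^{2α} ‖v s‖² ds)^{1/2}`, valued in `[0,∞]`. -/
def wL2 {E : Type*} [NormedAddCommGroup E] (α : ℝ) (v : ℝ → E) : ℝ≥0∞ :=
  (∫⁻ s in Set.Ioo (0:ℝ) 1, ENNReal.ofReal (s ^ (2 * α) * ‖v s‖ ^ 2)) ^ ((1:ℝ) / 2)

/-- The weighted L^∞ norm `‖s^α v‖_{L^∞(0,1)} = sup_{0<s<1} s^α ‖v s‖`, valued in `[0,∞]`. -/
def wLinf {E : Type*} [NormedAddCommGroup E] (α : ℝ) (v : ℝ → E) : ℝ≥0∞ :=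
  ⨆ s : Set.Ioo (0:ℝ) 1, ENNReal.ofReal ((s : ℝ) ^ α * ‖v (s : ℝ)‖)

/-- The square of the weighted Sobolev norm `X^m` on `(0,1)`:
for `m = 2k`, `‖u‖_{X^m}² = Σ_{i=0}^{k} ‖∂^i u‖² + Σ_{j=1}^{k} ‖s^j ∂^{k+j} u‖²`;
for `m = 2k+1`, `‖u‖_{X^m}² = Σ_{i=0}^{k} ‖∂^i u‖² + Σ_{j=1}^{k+1} ‖s^{j-1/2} ∂^{k+j} u‖²`. -/
def XnormSq {E : Type*} [NormedAddCommGroup E] [NormedSpace ℝ E] (m : ℕ) (u : ℝ → E) : ℝ≥0∞ :=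
  if m % 2 = 0 then
    (∑ i ∈ Finset.range (m / 2 + 1), wL2 0 (iteratedDeriv i u) ^ 2) +
      ∑ j ∈ Finset.range (m / 2), wL2 ((j : ℝ) + 1) (iteratedDeriv (m / 2 + j + 1) u) ^ 2
  else
    (∑ i ∈ Finset.range (m / 2 + 1), wL2 0 (iteratedDeriv i u) ^ 2) +
      ∑ j ∈ Finset.range (m / 2 + 1), wL2 ((j : ℝ) + 1 / 2) (iteratedDeriv (m / 2 + j + 1) u) ^ 2

/-- The weighted Sobolev norm `X^m`, valued in `[0,∞]`. -/
def Xnorm {E : Type*} [NormedAddCommGroup E] [NormedSpace ℝ E] (m : ℕ) (u : ℝ → E) : ℝ≥0∞ :=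
  XnormSq m u ^ ((1:ℝ) / 2)

/-- The square of the companion weighted Sobolev norm `Y^m` on `(0,1)`:
for `m = 2k`, `‖u‖_{Y^m}² = Σ_{i=0}^{k-1} ‖∂^i u‖² + Σ_{j=1}^{k+1} ‖s^{j-1/2} ∂^{k+j-1} u‖²`;
for `m = 2k+1`, `‖u‖_{Y^m}² = Σ_{i=0}^{k} ‖∂^i u‖² + Σ_{j=1}^{k+1} ‖s^{j} ∂^{k+j} u‖²`. -/
def YnormSq {E : Type*} [NormedAddCommGroup E] [NormedSpace ℝ E] (m : ℕ) (u : ℝ → E) : ℝ≥0∞ :=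
  if m % 2 = 0 then
    (∑ i ∈ Finset.range (m / 2), wL2 0 (iteratedDeriv i u) ^ 2) +
      ∑ j ∈ Finset.range (m / 2 + 1), wL2 ((j : ℝ) + 1 / 2) (iteratedDeriv (m / 2 + j) u) ^ 2
  else
    (∑ i ∈ Finset.range (m / 2 + 1), wL2 0 (iteratedDeriv i u) ^ 2) +
      ∑ j ∈ Finset.range (m / 2 + 1), wL2 ((j : ℝ) + 1) (iteratedDeriv (m / 2 + j + 1) u) ^ 2

/-- The weighted Sobolev norm `Y^m`, valued in `[0,∞]`. -/
def Ynorm {E : Type*} [NormedAddCommGroup E] [NormedSpace ℝ E] (m : ℕ) (u : ℝ → E) : ℝ≥0∞ :=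
  YnormSq m u ^ ((1:ℝ) / 2)

theorem aux_wL2 (α : ℝ) (v : ℝ → ℝ) (hv : ContinuousOn v (Set.Ioi 0)) (hf : wL2 α v ≠ ⊤) :
    IntegrableOn (fun s => s ^ (2 * α) * ‖v s‖ ^ 2) (Set.Ioo (0:ℝ) 1) ∧
    wL2 α v = ENNReal.ofReal (Real.sqrt (∫ s in Set.Ioo (0:ℝ) 1, s ^ (2 * α) * ‖v s‖ ^ 2)) := by
  have hc : ContinuousOn (fun s : ℝ => s ^ (2 * α) * ‖v s‖ ^ 2) (Set.Ioi 0) := by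
    apply ContinuousOn.mul
    · intro x hx
      exact (Real.continuousAt_rpow_const x _ (Or.inl (ne_of_gt hx))).continuousWithinAt
    · exact hv.norm.pow 2
  have hm : AEStronglyMeasurable (fun s : ℝ => s ^ (2 * α) * ‖v s‖ ^ 2)
      (volume.restrict (Set.Ioo (0:ℝ) 1)) :=
    (hc.mono (fun x hx => hx.1)).aestronglyMeasurable measurableSet_Ioo
  have hnn : 0 ≤ᵐ[volume.restrict (Set.Ioo (0:ℝ) 1)] (fun s : ℝ => s ^ (2 * α) * ‖v s‖ ^ 2) := by
    filter_upwards [ae_restrict_mem measurableSet_Ioo] with x hx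
    exact mul_nonneg (Real.rpow_nonneg hx.1.le _) (by positivity)
  have hl : (∫⁻ s in Set.Ioo (0:ℝ) 1, ENNReal.ofReal (s ^ (2 * α) * ‖v s‖ ^ 2)) ≠ ⊤ := by
    intro h
    apply hf
    rw [wL2, h]
    exact ENNReal.top_rpow_of_pos (by norm_num)
  have hi : IntegrableOn (fun s => s ^ (2 * α) * ‖v s‖ ^ 2) (Set.Ioo (0:ℝ) 1) :=
    (lintegral_ofReal_ne_top_iff_integrable hm hnn).1 hl
  refine ⟨hi, ?_⟩
  rw [wL2, ← ofReal_integral_eq_lintegral_ofReal hi hnn, Real.sqrt_eq_rpow,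
    ENNReal.ofReal_rpow_of_nonneg (integral_nonneg_of_ae hnn) (by norm_num)]

/-- weighted Sobolev-type embedding
`sup_{0<s<1} s^{β+1/2}|u(s)| ≤ C(‖s^β u‖_{L²} + ‖s^{β+1} u'‖_{L²})` for `β > -1/2`. -/
theorem stmt0 (β : ℝ) (hβ : -(1/2 : ℝ) < β) :
    ∃ C : ℝ, 0 < C ∧ ∀ u : ℝ → ℝ,
      ContDiffOn ℝ 1 u (Set.Ioi 0) →
      wL2 β u ≠ ⊤ → wL2 (β + 1) (deriv u) ≠ ⊤ →
      ∀ s ∈ Set.Ioo (0:ℝ) 1,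
        ENNReal.ofReal (s ^ (β + 1/2) * |u s|) ≤
          ENNReal.ofReal C * (wL2 β u + wL2 (β + 1) (deriv u)) := by
  refine ⟨Real.sqrt (2 * β + 4), Real.sqrt_pos.2 (by linarith), ?_⟩
  intro u hu h1 h2 s hs
  have hd : ∀ x : ℝ, 0 < x → HasDerivAt u (deriv u x) x := fun x hx =>
    ((hu.differentiableOn one_ne_zero).differentiableAt (Ioi_mem_nhds hx)).hasDerivAt
  have hcd : ContinuousOn (deriv u) (Set.Ioi 0) :=
    hu.continuousOn_deriv_of_isOpen isOpen_Ioi le_rfl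
  obtain ⟨iA, eA⟩ := aux_wL2 β u hu.continuousOn h1
  obtain ⟨iB, eB⟩ := aux_wL2 (β + 1) (deriv u) hcd h2
  rw [eA, eB]
  set A : ℝ → ℝ := fun s => s ^ (2 * β) * ‖u s‖ ^ 2 with hA
  set B : ℝ → ℝ := fun s => s ^ (2 * (β + 1)) * ‖deriv u s‖ ^ 2 with hB
  set a := ∫ s in Set.Ioo (0:ℝ) 1, A s with ha
  set b := ∫ s in Set.Ioo (0:ℝ) 1, B s with hb
  have hA0 : ∀ x : ℝ, 0 < x → 0 ≤ A x := fun x hx =>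
    mul_nonneg (Real.rpow_nonneg hx.le _) (by positivity)
  have hB0 : ∀ x : ℝ, 0 < x → 0 ≤ B x := fun x hx =>
    mul_nonneg (Real.rpow_nonneg hx.le _) (by positivity)
  have ha0 : 0 ≤ a := setIntegral_nonneg measurableSet_Ioo fun x hx => hA0 x hx.1
  have hb0 : 0 ≤ b := setIntegral_nonneg measurableSet_Ioo fun x hx => hB0 x hx.1
  obtain ⟨t, ht, hta⟩ : ∃ t ∈ Set.Ioo (0:ℝ) 1, A t ≤ a := by
    have := exists_le_setAverage (μ := volume) (s := Set.Ioo (0:ℝ) 1) (f := A)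
      (by simp) (by simp) iA
    simpa [setAverage_eq] using this
  let g : ℝ → ℝ := fun x => x ^ (2 * β + 1) * u x ^ 2
  let g' : ℝ → ℝ := fun x =>
    (2 * β + 1) * x ^ (2 * β) * u x ^ 2 + x ^ (2 * β + 1) * (2 * u x * deriv u x)
  have hg : ∀ x : ℝ, 0 < x → HasDerivAt g (g' x) x := by
    intro x hx
    have e1 := Real.hasDerivAt_rpow_const (x := x) (p := 2 * β + 1) (Or.inl hx.ne')
    have e2 := e1.mul ((hd x hx).pow 2)
    refine HasDerivAt.congr_deriv (f := g) e2 ?_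
    simp only [g', Pi.pow_apply, add_sub_cancel_right]
    push_cast
    ring
  have hr : ∀ p : ℝ, ContinuousOn (fun x : ℝ => x ^ p) (Set.Ioi 0) := fun p x hx =>
    (Real.continuousAt_rpow_const x _ (Or.inl (ne_of_gt hx))).continuousWithinAt
  have huc := hu.continuousOn
  have hg'c : ContinuousOn g' (Set.Ioi 0) :=
    ((continuousOn_const.mul (hr _)).mul (huc.pow 2)).add
      ((hr _).mul ((continuousOn_const.mul huc).mul hcd))
  have hbd : ∀ x : ℝ, 0 < x → ‖g' x‖ ≤ (2 * β + 2) * A x + B x := by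
    intro x hx
    have e1 : x ^ (2 * β + 1) = x ^ (2 * β) * x := by
      rw [Real.rpow_add hx, Real.rpow_one]
    have e2 : x ^ (2 * (β + 1)) = x ^ (2 * β) * x ^ 2 := by
      rw [← Real.rpow_natCast x 2, ← Real.rpow_add hx]; congr 1; push_cast; ring
    have hw : 0 ≤ x ^ (2 * β) := Real.rpow_nonneg hx.le _
    simp only [hA, hB, g', Real.norm_eq_abs, sq_abs]
    rw [e1, e2]
    generalize x ^ (2 * β) = w at *
    have k1 := mul_nonneg hw (sq_nonneg (u x + x * deriv u x))
    have k2 := mul_nonneg hw (sq_nonneg (u x - x * deriv u x))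
    have k3 := mul_nonneg (mul_nonneg hw (sq_nonneg (u x))) (by linarith : 0 ≤ 2 * β + 1)
    rw [abs_le]
    constructor <;> nlinarith
  have hsub : Set.uIcc t s ⊆ Set.Ioo (0:ℝ) 1 := Set.ordConnected_Ioo.uIcc_subset ht hs
  have hsub' : Set.uIoc t s ⊆ Set.Ioo (0:ℝ) 1 := Set.uIoc_subset_uIcc.trans hsub
  have hftc : ∫ x in t..s, g' x = g s - g t :=
    intervalIntegral.integral_eq_sub_of_hasDerivAt (fun x hx => hg x (hsub hx).1)
      (hg'c.mono fun x hx => (hsub hx).1).intervalIntegrable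
  have hAB : IntegrableOn (fun x => (2 * β + 2) * A x + B x) (Set.Ioo (0:ℝ) 1) :=
    (iA.const_mul _).add iB
  have hle : ‖g s - g t‖ ≤ (2 * β + 2) * a + b := by
    rw [← hftc]
    calc ‖∫ x in t..s, g' x‖ ≤ ∫ x in Set.uIoc t s, ‖g' x‖ :=
          intervalIntegral.norm_integral_le_integral_norm_uIoc
      _ ≤ ∫ x in Set.uIoc t s, ((2 * β + 2) * A x + B x) := by
          refine setIntegral_mono_on ?_ (hAB.mono_set hsub') measurableSet_uIoc
            fun x hx => hbd x (hsub' hx).1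
          exact (intervalIntegrable_iff.1
            (hg'c.mono fun x hx => (hsub hx).1).intervalIntegrable).norm
      _ ≤ ∫ x in Set.Ioo (0:ℝ) 1, ((2 * β + 2) * A x + B x) := by
          refine setIntegral_mono_set hAB ?_ hsub'.eventuallyLE
          filter_upwards [ae_restrict_mem measurableSet_Ioo] with x hx
          exact (norm_nonneg _).trans (hbd x hx.1)
      _ = (2 * β + 2) * a + b := by
          rw [integral_add (iA.const_mul _) iB, integral_const_mul]
  have hgt : g t ≤ a := by
    refine le_trans ?_ hta
    simp only [g, hA, Real.norm_eq_abs, sq_abs]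
    rw [Real.rpow_add ht.1, Real.rpow_one]
    have := mul_nonneg (Real.rpow_nonneg ht.1.le (2 * β)) (sq_nonneg (u t))
    nlinarith [ht.2]
  have hgs : g s ≤ (2 * β + 4) * (a + b) := by
    have := (le_abs_self _).trans hle
    nlinarith
  rw [← ENNReal.ofReal_add (Real.sqrt_nonneg _) (Real.sqrt_nonneg _),
    ← ENNReal.ofReal_mul (Real.sqrt_nonneg _)]
  apply ENNReal.ofReal_le_ofReal
  have hsq : (s ^ (β + 1/2) * |u s|) ^ 2 = g s := by
    simp only [g]
    rw [mul_pow, sq_abs, ← Real.rpow_natCast (s ^ (β + 1/2)) 2, ← Real.rpow_mul hs.1.le]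
    congr 2
    push_cast; ring
  refine (sq_le_sq₀ (mul_nonneg (Real.rpow_nonneg hs.1.le _) (abs_nonneg _)) (by positivity)).1 ?_
  rw [hsq, mul_pow, Real.sq_sqrt (by linarith)]
  refine hgs.trans (mul_le_mul_of_nonneg_left ?_ (by linarith))
  nlinarith [Real.sq_sqrt ha0, Real.sq_sqrt hb0,
    mul_nonneg (Real.sqrt_nonneg a) (Real.sqrt_nonneg b)]
end
end

section
/- Let ε ∈ (0, 1/2). There exists a constant C > 0 (depending only on ε) such that for every continuously differentiable function u : (0,1] → ℝ with ‖u‖_{L²(0,1)} and ‖s^{1/2+ε} u'‖_{L²(0,1)} finite, one has sup_{0<s<1} s^{ε}|u(s)| ≤ C ( ‖u‖_{L²(0,1)} + ‖s^{1/2+ε} u'‖_{L²(0,1)} ). -/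
open MeasureTheory ENNReal RealInnerProductSpace

noncomputable section

/-- Weighted Cauchy Schwarz increment bound. -/
lemma incr_bound (ε : ℝ) (hε : 0 < ε) (u : ℝ → ℝ) (hu : ContDiffOn ℝ 1 u (Set.Ioi 0))
    (a b : ℝ) (ha : 0 < a) (hab : a ≤ b) (hb : b < 1) :
    ENNReal.ofReal |u b - u a| ≤
      ENNReal.ofReal ((a ^ (-(2 * ε)) / (2 * ε)) ^ ((1:ℝ) / 2)) * wL2 (1/2 + ε) (deriv u) := by
  have hsub : ∀ x ∈ Set.uIcc a b, 0 < x := by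
    intro x hx
    rw [Set.uIcc_of_le hab] at hx
    exact ha.trans_le hx.1
  have hcont : ContinuousOn (deriv u) (Set.Ioi 0) :=
    hu.continuousOn_deriv_of_isOpen isOpen_Ioi le_rfl
  have hftc : ∫ y in a..b, deriv u y = u b - u a := by
    apply intervalIntegral.integral_eq_sub_of_hasDerivAt
    · intro x hx
      exact ((hu.differentiableOn one_ne_zero).differentiableAt
        (Ioi_mem_nhds (hsub x hx))).hasDerivAt
    · exact (hcont.mono hsub).intervalIntegrable
  have hmeas : AEMeasurable (deriv u) (volume.restrict (Set.Ioc a b)) :=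
    (measurable_deriv u).aemeasurable
  have h1 : ENNReal.ofReal |u b - u a| ≤ ∫⁻ x in Set.Ioc a b, ‖deriv u x‖ₑ := by
    rw [← hftc, intervalIntegral.integral_of_le hab, ← Real.norm_eq_abs, ofReal_norm]
    exact enorm_integral_le_lintegral_enorm _
  have h2 : ∫⁻ x in Set.Ioc a b, ‖deriv u x‖ₑ =
      ∫⁻ x in Set.Ioc a b, ((fun x : ℝ => ENNReal.ofReal (x ^ (-(1/2 + ε)))) *
        (fun x : ℝ => ENNReal.ofReal (x ^ (1/2 + ε) * |deriv u x|))) x := by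
    apply setLIntegral_congr_fun measurableSet_Ioc
    intro x hx
    have hx0 : 0 < x := ha.trans hx.1
    simp only [Pi.mul_apply]
    rw [← ENNReal.ofReal_mul (by positivity), ← mul_assoc, ← Real.rpow_add hx0,
      neg_add_cancel, Real.rpow_zero, one_mul, ← Real.norm_eq_abs, ofReal_norm]
  have h3 := ENNReal.lintegral_mul_le_Lp_mul_Lq (volume.restrict (Set.Ioc a b))
    Real.HolderConjugate.two_two
    (f := fun x : ℝ => ENNReal.ofReal (x ^ (-(1/2 + ε))))
    (g := fun x : ℝ => ENNReal.ofReal (x ^ (1/2 + ε) * |deriv u x|))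
    (by fun_prop) (by
      have := measurable_deriv u
      apply Measurable.aemeasurable
      apply Measurable.ennreal_ofReal
      exact (measurable_id.pow_const _).mul (continuous_abs.measurable.comp this))
  rw [h2] at h1
  refine h1.trans (h3.trans ?_)
  gcongr
  · rw [← ENNReal.ofReal_rpow_of_nonneg (by positivity) (by norm_num)]
    gcongr
    have e1 : ∫⁻ x in Set.Ioc a b, ENNReal.ofReal (x ^ (-(1/2 + ε))) ^ (2:ℝ) =
        ∫⁻ x in Set.Ioc a b, ENNReal.ofReal (x ^ (-1 - 2 * ε)) := by
      apply setLIntegral_congr_fun measurableSet_Ioc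
      intro x hx
      have hx0 : 0 < x := ha.trans hx.1
      simp only
      rw [ENNReal.ofReal_rpow_of_nonneg (by positivity) (by norm_num), ← Real.rpow_mul hx0.le]
      congr 2
      ring
    have hz : (0:ℝ) ∉ Set.uIcc a b := fun h => lt_irrefl _ (hsub 0 h)
    have hint : IntervalIntegrable (fun x : ℝ => x ^ (-1 - 2 * ε)) volume a b :=
      intervalIntegral.intervalIntegrable_rpow (Or.inr hz)
    rw [e1, ← ofReal_integral_eq_lintegral_ofReal
      ((intervalIntegrable_iff_integrableOn_Ioc_of_le hab).1 hint),
      ← intervalIntegral.integral_of_le hab, integral_rpow (Or.inr ⟨by linarith, hz⟩)]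
    · apply ENNReal.ofReal_le_ofReal
      have e2 : -1 - 2 * ε + 1 = -(2 * ε) := by ring
      rw [e2, div_neg, ← neg_div]
      gcongr
      have : 0 < b ^ (-(2 * ε)) := Real.rpow_pos_of_pos (ha.trans_le hab) _
      linarith
    · filter_upwards [ae_restrict_mem measurableSet_Ioc] with x hx
      have hx0 : 0 < x := ha.trans hx.1
      simp only [Pi.zero_apply]
      positivity
  · unfold wL2
    refine ENNReal.rpow_le_rpow ?_ (by norm_num)
    calc ∫⁻ x in Set.Ioc a b, ENNReal.ofReal (x ^ (1/2 + ε) * |deriv u x|) ^ (2:ℝ)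
        = ∫⁻ x in Set.Ioc a b, ENNReal.ofReal (x ^ (2 * (1/2 + ε)) * ‖deriv u x‖ ^ 2) := by
          apply setLIntegral_congr_fun measurableSet_Ioc
          intro x hx
          have hx0 : 0 < x := ha.trans hx.1
          simp only
          rw [ENNReal.ofReal_rpow_of_nonneg (by positivity) (by norm_num), Real.rpow_two,
            mul_pow, mul_comm 2, Real.rpow_mul hx0.le, Real.rpow_two, Real.norm_eq_abs]
      _ ≤ _ := by
          apply lintegral_mono_set
          intro x hx
          exact ⟨ha.trans hx.1, hx.2.trans_lt hb⟩

/-- A point where `u` is controlled by its L² norm. -/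
lemma good_point (u : ℝ → ℝ) (hu : ContDiffOn ℝ 1 u (Set.Ioi 0)) :
    ∃ t ∈ Set.Ioo (1/2 : ℝ) 1, ENNReal.ofReal |u t| ≤ 2 * wL2 0 u := by
  have hv : volume (Set.Ioo (1/2 : ℝ) 1) = 2⁻¹ := by
    rw [Real.volume_Ioo, show (1:ℝ) - 1/2 = 2⁻¹ by norm_num, ENNReal.ofReal_inv_of_pos two_pos]
    simp
  have hc : ContinuousOn (fun s : ℝ => s ^ (2 * (0:ℝ)) * ‖u s‖ ^ 2) (Set.Ioo (1/2 : ℝ) 1) := by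
    have : ContinuousOn u (Set.Ioo (1/2 : ℝ) 1) := hu.continuousOn.mono (fun x hx => by
      have := hx.1
      simp only [Set.mem_Ioi]
      linarith)
    simp only [mul_zero, Real.rpow_zero, one_mul]
    fun_prop
  obtain ⟨t, ht, h⟩ := exists_le_setLAverage (μ := volume) (s := Set.Ioo (1/2 : ℝ) 1)
    (f := fun s : ℝ => ENNReal.ofReal (s ^ (2 * (0:ℝ)) * ‖u s‖ ^ 2))
    (by rw [hv]; simp) (by rw [hv]; simp)
    (hc.aemeasurable measurableSet_Ioo).ennreal_ofReal
  refine ⟨t, ht, ?_⟩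
  rw [setLAverage_eq, hv, ENNReal.div_eq_inv_mul, inv_inv] at h
  have h' : ENNReal.ofReal |u t| ^ (2:ℝ) ≤ 2 * (wL2 0 u) ^ (2:ℝ) := by
    calc _ = ENNReal.ofReal (t ^ (2 * (0:ℝ)) * ‖u t‖ ^ 2) := by
          rw [ENNReal.ofReal_rpow_of_nonneg (abs_nonneg _) (by norm_num)]
          simp
      _ ≤ _ := h
      _ ≤ _ := by
          unfold wL2
          rw [← ENNReal.rpow_mul]
          norm_num only
          rw [ENNReal.rpow_one]
          gcongr
          norm_num
  have h4 : ENNReal.ofReal |u t| ^ (2:ℝ) ≤ (2 * wL2 0 u) ^ (2:ℝ) := by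
    refine h'.trans ?_
    rw [ENNReal.mul_rpow_of_nonneg _ _ (by norm_num)]
    gcongr
    norm_num
  exact (ENNReal.rpow_le_rpow_iff two_pos).1 h4

/-- `sup_{0<s<1} s^ε|u(s)| ≤ C(‖u‖_{L²} + ‖s^{1/2+ε} u'‖_{L²})` for `0 < ε < 1/2`. -/
theorem stmt1 (ε : ℝ) (hε : ε ∈ Set.Ioo (0:ℝ) (1/2)) :
    ∃ C : ℝ, 0 < C ∧ ∀ u : ℝ → ℝ,
      ContDiffOn ℝ 1 u (Set.Ioi 0) →
      wL2 0 u ≠ ⊤ → wL2 (1/2 + ε) (deriv u) ≠ ⊤ →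
      ∀ s ∈ Set.Ioo (0:ℝ) 1,
        ENNReal.ofReal (s ^ ε * |u s|) ≤
          ENNReal.ofReal C * (wL2 0 u + wL2 (1/2 + ε) (deriv u)) := by
  obtain ⟨h0, h12⟩ := hε
  have hK : 0 < (1 / (2 * ε)) ^ ((1:ℝ) / 2) := by positivity
  refine ⟨2 + 2 * (1 / (2 * ε)) ^ ((1:ℝ) / 2), by positivity, ?_⟩
  set K := (1 / (2 * ε)) ^ ((1:ℝ) / 2) with hKdef
  intro u hu hA hB s hs
  obtain ⟨hs0, hs1⟩ := hs
  obtain ⟨t, ht, hut⟩ := good_point u hu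
  have ht0 : 0 < t := by linarith [ht.1]
  have hse : s ^ ε ≤ 1 := Real.rpow_le_one hs0.le hs1.le h0.le
  have hse0 : 0 < s ^ ε := Real.rpow_pos_of_pos hs0 _
  have key : ∀ a, 0 < a → (a ^ (-(2 * ε)) / (2 * ε)) ^ ((1:ℝ) / 2) = a ^ (-ε) * K := by
    intro a ha
    rw [div_eq_mul_one_div, Real.mul_rpow (by positivity) (by positivity), ← Real.rpow_mul ha.le]
    congr 2
    ring
  have hdiff : ∃ c : ℝ, 0 ≤ c ∧ s ^ ε * c ≤ 2 * K ∧
      ENNReal.ofReal |u s - u t| ≤ ENNReal.ofReal c * wL2 (1/2 + ε) (deriv u) := by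
    rcases le_total s t with hst | hst
    · refine ⟨s ^ (-ε) * K, by positivity, ?_, ?_⟩
      · rw [← mul_assoc, ← Real.rpow_add hs0, add_neg_cancel, Real.rpow_zero]
        linarith
      · rw [abs_sub_comm, ← key s hs0]
        exact incr_bound ε h0 u hu s t hs0 hst ht.2
    · refine ⟨t ^ (-ε) * K, by positivity, ?_, ?_⟩
      · have h1 : t ^ (-ε) ≤ 2 := by
          calc t ^ (-ε) ≤ (1/2 : ℝ) ^ (-ε) :=
                Real.rpow_le_rpow_of_nonpos (by norm_num) ht.1.le (by linarith)
            _ ≤ (1/2 : ℝ) ^ (-1 : ℝ) :=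
                Real.rpow_le_rpow_of_exponent_ge (by norm_num) (by norm_num) (by linarith)
            _ = 2 := by rw [Real.rpow_neg_one]; norm_num
        have h2 : t ^ (-ε) * K ≤ 2 * K := by gcongr
        have h3 : 0 ≤ t ^ (-ε) * K := by positivity
        nlinarith
      · rw [← key t ht0]
        exact incr_bound ε h0 u hu t s ht0 hst hs1
  obtain ⟨c, hc0, hc, hd⟩ := hdiff
  lift wL2 0 u to NNReal using hA with A
  lift wL2 (1/2 + ε) (deriv u) to NNReal using hB with B
  have hut' : |u t| ≤ 2 * (A:ℝ) := by
    rw [← ENNReal.ofReal_coe_nnreal, show (2 : ℝ≥0∞) = ENNReal.ofReal 2 by simp,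
      ← ENNReal.ofReal_mul (by norm_num)] at hut
    exact (ENNReal.ofReal_le_ofReal_iff (by positivity)).1 hut
  have hd' : |u s - u t| ≤ c * (B:ℝ) := by
    rw [← ENNReal.ofReal_coe_nnreal, ← ENNReal.ofReal_mul hc0] at hd
    exact (ENNReal.ofReal_le_ofReal_iff (by positivity)).1 hd
  rw [← ENNReal.coe_add, ← ENNReal.ofReal_coe_nnreal, ← ENNReal.ofReal_mul (by positivity)]
  apply ENNReal.ofReal_le_ofReal
  push_cast
  have hA0 : (0:ℝ) ≤ A := A.2
  have hB0 : (0:ℝ) ≤ B := B.2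
  have h5 : |u s| ≤ 2 * A + c * B := by
    have := abs_sub_abs_le_abs_sub (u s) (u t)
    linarith
  calc s ^ ε * |u s| ≤ s ^ ε * (2 * A + c * B) := by gcongr
    _ = s ^ ε * (2 * A) + (s ^ ε * c) * B := by ring
    _ ≤ 1 * (2 * A) + (2 * K) * B := by gcongr
    _ ≤ _ := by nlinarith [mul_nonneg hK.le hA0]
end
end

section
/- For each ε ∈ (0, 1/2) there exists a constant C ≥ 1 such that for every smooth function u on (0,1] (with all quantities below finite) the following three norm equivalences hold: (k=1) C^{-1}(‖u‖_{L²}² + ‖s^{1/2+ε}u'‖_{L²}²) ≤ ‖s^ε u‖_{L^∞}² + ‖s^{1/2+ε}u'‖_{L²}² ≤ C(‖u‖_{L²}² + ‖s^{1/2+ε}u'‖_{L²}²); (k=2) C^{-1}(‖u‖_{L²}² + ‖s^ε u'‖_{L²}² + ‖s^{1+ε}u''‖_{L²}²) ≤ ‖u‖_{L^∞}² + ‖s^ε u'‖_{L²}² + ‖s^{1+ε}u''‖_{L²}² ≤ C(‖u‖_{L²}² + ‖s^ε u'‖_{L²}² + ‖s^{1+ε}u''‖_{L²}²); (k=3) C^{-1}(‖u‖_{H¹}²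 + ‖s^{1/2+ε}u''‖_{L²}² + ‖s^{3/2+ε}u'''‖_{L²}²) ≤ ‖u‖_{L^∞}² + ‖s^ε u'‖_{L^∞}² + ‖s^{1/2+ε}u''‖_{L²}² + ‖s^{3/2+ε}u'''‖_{L²}² ≤ C(‖u‖_{H¹}² + ‖s^{1/2+ε}u''‖_{L²}² + ‖s^{3/2+ε}u'''‖_{L²}²). -/
open MeasureTheory ENNReal RealInnerProductSpace

noncomputable section

theorem wL2_sq (α : ℝ) (v : ℝ → ℝ) :
    wL2 α v ^ 2 = ∫⁻ s in Set.Ioo (0:ℝ) 1, ENNReal.ofReal (s ^ (2 * α) * ‖v s‖ ^ 2) := by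
  unfold wL2
  rw [← ENNReal.rpow_natCast, ← ENNReal.rpow_mul]
  norm_num

theorem wL2_real (α : ℝ) (v : ℝ → ℝ) (hv : ContinuousOn v (Set.Ioi 0)) (h : wL2 α v ≠ ⊤) :
    IntegrableOn (fun s : ℝ => s ^ (2 * α) * v s ^ 2) (Set.Ioo 0 1) ∧
    wL2 α v ^ 2 = ENNReal.ofReal (∫ s in Set.Ioo (0:ℝ) 1, s ^ (2 * α) * v s ^ 2) := by
  have hc : ContinuousOn (fun s : ℝ => s ^ (2 * α) * v s ^ 2) (Set.Ioo 0 1) := by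
    apply ContinuousOn.mul
    · apply ContinuousOn.rpow_const continuousOn_id
      intro x hx
      left
      exact hx.1.ne'
    · exact (hv.mono (fun x hx => hx.1)).pow 2
  have hm := hc.aestronglyMeasurable (μ := volume) measurableSet_Ioo
  have hnn : 0 ≤ᵐ[volume.restrict (Set.Ioo (0:ℝ) 1)] (fun s : ℝ => s ^ (2 * α) * v s ^ 2) := by
    filter_upwards [ae_restrict_mem measurableSet_Ioo] with x hx
    have := Real.rpow_nonneg hx.1.le (2 * α)
    simp only [Pi.zero_apply]
    positivity
  have hsq : wL2 α v ^ 2 = ∫⁻ s in Set.Ioo (0:ℝ) 1, ENNReal.ofReal (s ^ (2 * α) * v s ^ 2) := by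
    rw [wL2_sq]
    simp
  have hfin : wL2 α v ^ 2 ≠ ⊤ := ENNReal.pow_ne_top h
  have hint : IntegrableOn (fun s : ℝ => s ^ (2 * α) * v s ^ 2) (Set.Ioo 0 1) := by
    refine ⟨hm, ?_⟩
    rw [hasFiniteIntegral_iff_ofReal hnn, ← hsq]
    exact hfin.lt_top
  exact ⟨hint, by rw [hsq, ofReal_integral_eq_lintegral_ofReal hint hnn]⟩

/-- the basic weighted pointwise bound -/
theorem core_bound (α : ℝ) (hα : 0 ≤ α) (u u' w w' : ℝ → ℝ) (W K : ℝ) (hW : 0 ≤ W) (hK : 0 ≤ K)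
    (hu : ∀ r, 0 < r → HasDerivAt u (u' r) r)
    (hw : ∀ r, 0 < r → HasDerivAt w (w' r) r)
    (hw' : ∀ r, 0 < r → 0 < w' r)
    (hwW : ∀ r, 0 < r → r < 1 → w r ≤ W)
    (hwK : ∀ r, 0 < r → r < 1 → w r ^ 2 ≤ K * (w' r * r ^ (2 * α)))
    (hA : IntegrableOn (fun s : ℝ => s ^ (2 * (0:ℝ)) * u s ^ 2) (Set.Ioo 0 1))
    (hB : IntegrableOn (fun s : ℝ => s ^ (2 * α) * u' s ^ 2) (Set.Ioo 0 1))
    (s : ℝ) (hs : s ∈ Set.Ioo (0:ℝ) 1) :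
    w s * u s ^ 2 ≤ 4 * W * (∫ s in Set.Ioo (0:ℝ) 1, s ^ (2 * (0:ℝ)) * u s ^ 2) +
      (4 * W * 2 ^ (2 * α) + K) * (∫ s in Set.Ioo (0:ℝ) 1, s ^ (2 * α) * u' s ^ 2) := by
  set A := ∫ s in Set.Ioo (0:ℝ) 1, s ^ (2 * (0:ℝ)) * u s ^ 2 with hAdef
  set B := ∫ s in Set.Ioo (0:ℝ) 1, s ^ (2 * α) * u' s ^ 2 with hBdef
  have hBnn : 0 ≤ B := by
    apply setIntegral_nonneg measurableSet_Ioo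
    intro x hx
    have := Real.rpow_nonneg hx.1.le (2 * α)
    positivity
  -- integrals over subintervals
  have hsubI : ∀ a b : ℝ, 0 < a → b < 1 →
      IntegrableOn (fun s : ℝ => s ^ (2 * α) * u' s ^ 2) (Set.Icc a b) := by
    intro a b ha hb
    exact hB.mono_set (fun x hx => ⟨ha.trans_le hx.1, hx.2.trans_lt hb⟩)
  have hsub : ∀ a b : ℝ, 0 < a → a ≤ b → b < 1 →
      ∫ s in a..b, s ^ (2 * α) * u' s ^ 2 ≤ B := by
    intro a b ha hab hb
    rw [intervalIntegral.integral_of_le hab]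
    apply setIntegral_mono_set hB
    · filter_upwards [ae_restrict_mem measurableSet_Ioo] with x hx
      have := Real.rpow_nonneg hx.1.le (2 * α)
      simp only [Pi.zero_apply]
      positivity
    · apply Filter.Eventually.of_forall
      intro x hx
      exact ⟨ha.trans hx.1, hx.2.trans_lt hb⟩
  have hp0 : (0:ℝ) < 2 ^ (2 * α) := by positivity
  have key : ∀ t ∈ Set.Ioo (1/2 : ℝ) 1,
      w s * u s ^ 2 ≤ W * (2 * u t ^ 2 + 4 * 2 ^ (2 * α) * B) + K * B := by
    intro t ht
    have ht0 : (0:ℝ) < t := by linarith [ht.1]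
    rcases le_total s t with hst | hts
    · have hd : ∀ r, 0 < r → HasDerivAt (fun r => -(w r * u r ^ 2))
          (-(w' r * u r ^ 2 + w r * (2 * u r * u' r))) r := by
        intro r hr
        have := ((hw r hr).mul ((hu r hr).pow 2)).neg
        refine HasDerivAt.congr_deriv this ?_
        simp
      have h1 := intervalIntegral.sub_le_integral_of_hasDeriv_right_of_le hst
        (g := fun r => -(w r * u r ^ 2))
        (g' := fun r => -(w' r * u r ^ 2 + w r * (2 * u r * u' r)))
        (φ := fun r => K * (r ^ (2 * α) * u' r ^ 2))
        (fun r hr => (hd r (hs.1.trans_le hr.1)).continuousAt.continuousWithinAt)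
        (fun r hr => (hd r (hs.1.trans hr.1)).hasDerivWithinAt)
        ((hsubI s t hs.1 ht.2).const_mul K)
        (by
          intro r hr
          have hr0 : 0 < r := hs.1.trans hr.1
          have hr1 : r < 1 := hr.2.trans ht.2
          have hp := hw' r hr0
          have hk := mul_le_mul_of_nonneg_right (hwK r hr0 hr1) (sq_nonneg (u' r))
          have : 0 ≤ w' r * (K * (r ^ (2 * α) * u' r ^ 2)
              + (w' r * u r ^ 2 + w r * (2 * u r * u' r))) := by
            nlinarith [sq_nonneg (w' r * u r + w r * u' r)]
          have := nonneg_of_mul_nonneg_right this hp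
          linarith)
      rw [intervalIntegral.integral_const_mul] at h1
      have h2 := mul_le_mul_of_nonneg_left (hsub s t hs.1 hst ht.2) hK
      have h3 := mul_le_mul_of_nonneg_right (hwW t ht0 ht.2) (sq_nonneg (u t))
      have h4 : 0 ≤ W * (u t ^ 2 + 4 * 2 ^ (2 * α) * B) := by positivity
      nlinarith
    · have hd : ∀ r, 0 < r → HasDerivAt (fun r => (2 - r) * u r ^ 2)
          (-1 * u r ^ 2 + (2 - r) * (2 * u r * u' r)) r := by
        intro r hr
        have := ((hasDerivAt_id r).const_sub 2).mul ((hu r hr).pow 2)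
        refine HasDerivAt.congr_deriv this ?_
        simp
      have h1 := intervalIntegral.sub_le_integral_of_hasDeriv_right_of_le hts
        (g := fun r => (2 - r) * u r ^ 2)
        (g' := fun r => (-1 * u r ^ 2 + (2 - r) * (2 * u r * u' r)))
        (φ := fun r => (4 * 2 ^ (2 * α)) * (r ^ (2 * α) * u' r ^ 2))
        (fun r hr => (hd r (ht0.trans_le hr.1)).continuousAt.continuousWithinAt)
        (fun r hr => (hd r (ht0.trans hr.1)).hasDerivWithinAt)
        ((hsubI t s ht0 hs.2).const_mul _)
        (by
          intro r hr
          have hr0 : 0 < r := ht0.trans hr.1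
          have hr1 : r < 1 := hr.2.trans hs.2
          have hr2 : 1/2 < r := ht.1.trans hr.1
          have h5 : (1:ℝ) ≤ 2 ^ (2 * α) * r ^ (2 * α) := by
            rw [← Real.mul_rpow (by norm_num) hr0.le]
            exact Real.one_le_rpow (by linarith) (by linarith)
          have h6 := mul_le_mul_of_nonneg_right h5 (sq_nonneg (u' r))
          have h7 : (2 - r) ^ 2 * u' r ^ 2 ≤ 4 * u' r ^ 2 := by
            apply mul_le_mul_of_nonneg_right _ (sq_nonneg _)
            nlinarith
          nlinarith [sq_nonneg (u r - (2 - r) * u' r)])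
      rw [intervalIntegral.integral_const_mul] at h1
      have h2 := mul_le_mul_of_nonneg_left (hsub t s ht0 hts hs.2)
        (by positivity : (0:ℝ) ≤ 4 * 2 ^ (2 * α))
      have h3 : u s ^ 2 ≤ 2 * u t ^ 2 + 4 * 2 ^ (2 * α) * B := by
        have a1 : u s ^ 2 ≤ (2 - s) * u s ^ 2 := by nlinarith [sq_nonneg (u s), hs.2]
        have a2 : (2 - t) * u t ^ 2 ≤ 2 * u t ^ 2 := by nlinarith [sq_nonneg (u t)]
        linarith
      have h4 := mul_le_mul_of_nonneg_right (hwW s hs.1 hs.2) (sq_nonneg (u s))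
      have h5 := mul_le_mul_of_nonneg_left h3 hW
      have h6 : 0 ≤ K * B := by positivity
      linarith
  -- average in t
  have hA' : IntegrableOn (fun s : ℝ => u s ^ 2) (Set.Ioo 0 1) := by simpa using hA
  have hA2 : IntegrableOn (fun s : ℝ => u s ^ 2) (Set.Ioo (1/2) 1) :=
    hA'.mono_set (fun x hx => ⟨by linarith [hx.1], hx.2⟩)
  have hAle : ∫ t in Set.Ioo (1/2 : ℝ) 1, u t ^ 2 ≤ A := by
    have : A = ∫ t in Set.Ioo (0 : ℝ) 1, u t ^ 2 := by simp [hAdef]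
    rw [this]
    apply setIntegral_mono_set hA'
    · exact Filter.Eventually.of_forall (fun x => sq_nonneg (u x))
    · apply Filter.Eventually.of_forall
      intro x hx
      exact ⟨by linarith [hx.1], hx.2⟩
  have hfin : volume (Set.Ioo (1/2:ℝ) 1) ≠ ⊤ := by simp
  have hJ : IntegrableOn (fun t => (2 * W) * u t ^ 2 + (W * (4 * 2 ^ (2 * α) * B) + K * B))
      (Set.Ioo (1/2:ℝ) 1) := (hA2.const_mul (2 * W)).add (integrableOn_const hfin)
  have hI := setIntegral_mono_on (μ := volume) (s := Set.Ioo (1/2:ℝ) 1)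
    (f := fun _ => w s * u s ^ 2)
    (g := fun t => (2 * W) * u t ^ 2 + (W * (4 * 2 ^ (2 * α) * B) + K * B))
    (integrableOn_const hfin) hJ
    measurableSet_Ioo (fun t ht => by linarith [key t ht])
  rw [integral_add (hA2.const_mul _) (integrableOn_const hfin), setIntegral_const,
    setIntegral_const] at hI
  have hm : ∫ t in Set.Ioo (1/2 : ℝ) 1, (2 * W) * u t ^ 2 =
      (2 * W) * ∫ t in Set.Ioo (1/2 : ℝ) 1, u t ^ 2 := integral_const_mul _ _
  rw [hm] at hI
  have hv : volume.real (Set.Ioo (1/2:ℝ) 1) = 1/2 := by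
    rw [Real.volume_real_Ioo_of_le (by norm_num)]
    norm_num
  rw [hv] at hI
  simp only [smul_eq_mul] at hI
  have := mul_le_mul_of_nonneg_left hAle hW
  linarith

theorem core_Linf (α β : ℝ) (hα : 0 ≤ α) (w w' : ℝ → ℝ) (W K : ℝ) (hW : 0 ≤ W) (hK : 0 ≤ K)
    (hw : ∀ r, 0 < r → HasDerivAt w (w' r) r)
    (hw' : ∀ r, 0 < r → 0 < w' r)
    (hwW : ∀ r, 0 < r → r < 1 → w r ≤ W)
    (hwK : ∀ r, 0 < r → r < 1 → w r ^ 2 ≤ K * (w' r * r ^ (2 * α)))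
    (hwβ : ∀ r, 0 < r → r < 1 → (r ^ β) ^ 2 ≤ w r) :
    ∃ C : ℝ, 0 ≤ C ∧ ∀ u : ℝ → ℝ, ContDiffOn ℝ 1 u (Set.Ioi 0) →
      wL2 0 u ≠ ⊤ → wL2 α (deriv u) ≠ ⊤ →
      wLinf β u ^ 2 ≤ ENNReal.ofReal C * (wL2 0 u ^ 2 + wL2 α (deriv u) ^ 2) := by
  have hp0 : (0:ℝ) < 2 ^ (2 * α) := by positivity
  refine ⟨4 * W + (4 * W * 2 ^ (2 * α) + K), by positivity, ?_⟩
  intro u hu h0 h1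
  have hud : ∀ r, 0 < r → HasDerivAt u (deriv u r) r := by
    intro r hr
    exact ((hu.differentiableOn (by norm_num)).differentiableAt (Ioi_mem_nhds hr)).hasDerivAt
  have hu'c : ContinuousOn (deriv u) (Set.Ioi 0) :=
    hu.continuousOn_deriv_of_isOpen isOpen_Ioi (by norm_num)
  obtain ⟨hA, eA⟩ := wL2_real 0 u hu.continuousOn h0
  obtain ⟨hB, eB⟩ := wL2_real α (deriv u) hu'c h1
  have hb := core_bound α hα u (deriv u) w w' W K hW hK hud hw hw' hwW hwK hA hB
  rw [eA, eB]
  have hAnn : 0 ≤ ∫ s in Set.Ioo (0:ℝ) 1, s ^ (2 * (0:ℝ)) * u s ^ 2 := by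
    apply setIntegral_nonneg measurableSet_Ioo
    intro x hx
    have := Real.rpow_nonneg hx.1.le (2 * (0:ℝ))
    positivity
  have hBnn : 0 ≤ ∫ s in Set.Ioo (0:ℝ) 1, s ^ (2 * α) * deriv u s ^ 2 := by
    apply setIntegral_nonneg measurableSet_Ioo
    intro x hx
    have := Real.rpow_nonneg hx.1.le (2 * α)
    positivity
  generalize (∫ s in Set.Ioo (0:ℝ) 1, s ^ (2 * (0:ℝ)) * u s ^ 2) = A at *
  generalize (∫ s in Set.Ioo (0:ℝ) 1, s ^ (2 * α) * deriv u s ^ 2) = B at *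
  rw [← ENNReal.ofReal_add hAnn hBnn, ← ENNReal.ofReal_mul (by positivity)]
  set R := (4 * W + (4 * W * 2 ^ (2 * α) + K)) * (A + B) with hR
  have hRnn : 0 ≤ R := by positivity
  have hle : wLinf β u ≤ ENNReal.ofReal (Real.sqrt R) := by
    unfold wLinf
    apply iSup_le
    rintro ⟨s, hs⟩
    apply ENNReal.ofReal_le_ofReal
    apply Real.le_sqrt_of_sq_le
    rw [mul_pow, Real.norm_eq_abs, sq_abs]
    have h2 := mul_le_mul_of_nonneg_right (hwβ s hs.1 hs.2) (sq_nonneg (u s))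
    have h3 : 0 ≤ 4 * W * B := by positivity
    have h4 : 0 ≤ (4 * W * 2 ^ (2 * α) + K) * A := by positivity
    have h5 := hb s hs
    rw [hR]
    simp only at *
    nlinarith
  calc wLinf β u ^ 2 ≤ ENNReal.ofReal (Real.sqrt R) ^ 2 := by gcongr
    _ = ENNReal.ofReal R := by
      rw [← ENNReal.ofReal_pow (Real.sqrt_nonneg _), Real.sq_sqrt hRnn]

theorem upper_one (ε : ℝ) (hε : 0 < ε) :
    ∃ C : ℝ, 0 ≤ C ∧ ∀ u : ℝ → ℝ, ContDiffOn ℝ 1 u (Set.Ioi 0) →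
      wL2 0 u ≠ ⊤ → wL2 (1/2 + ε) (deriv u) ≠ ⊤ →
      wLinf ε u ^ 2 ≤ ENNReal.ofReal C * (wL2 0 u ^ 2 + wL2 (1/2 + ε) (deriv u) ^ 2) := by
  apply core_Linf (1/2 + ε) ε (by linarith) (fun r => r ^ (2 * ε))
    (fun r => (2 * ε) * r ^ (2 * ε - 1)) 1 (1 / (2 * ε)) (by norm_num) (by positivity)
  · intro r hr
    exact Real.hasDerivAt_rpow_const (Or.inl hr.ne')
  · intro r hr
    positivity
  · intro r hr hr1
    exact Real.rpow_le_one hr.le hr1.le (by linarith)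
  · intro r hr hr1
    apply le_of_eq
    rw [mul_assoc (2 * ε), ← Real.rpow_add hr, ← mul_assoc, one_div_mul_cancel (by positivity),
      one_mul, ← Real.rpow_natCast, ← Real.rpow_mul hr.le]
    congr 1
    push_cast
    ring
  · intro r hr hr1
    apply le_of_eq
    rw [← Real.rpow_natCast, ← Real.rpow_mul hr.le]
    congr 1
    push_cast
    ring

theorem upper_two (ε : ℝ) (hε : 0 ≤ ε) (hε2 : ε < 1/2) :
    ∃ C : ℝ, 0 ≤ C ∧ ∀ u : ℝ → ℝ, ContDiffOn ℝ 1 u (Set.Ioi 0) →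
      wL2 0 u ≠ ⊤ → wL2 ε (deriv u) ≠ ⊤ →
      wLinf 0 u ^ 2 ≤ ENNReal.ofReal C * (wL2 0 u ^ 2 + wL2 ε (deriv u) ^ 2) := by
  have hd : 0 < 1 - 2 * ε := by linarith
  have hW : ∀ r : ℝ, 0 < r → r < 1 →
      1 + r ^ (1 - 2 * ε) / (1 - 2 * ε) ≤ 1 + 1 / (1 - 2 * ε) := by
    intro r hr hr1
    have := Real.rpow_le_one hr.le hr1.le hd.le
    gcongr
  apply core_Linf ε 0 hε (fun r => 1 + r ^ (1 - 2 * ε) / (1 - 2 * ε))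
    (fun r => r ^ (- (2 * ε))) (1 + 1 / (1 - 2 * ε)) ((1 + 1 / (1 - 2 * ε)) ^ 2)
    (by positivity) (by positivity)
  · intro r hr
    have := ((Real.hasDerivAt_rpow_const (x := r) (p := 1 - 2 * ε)
      (Or.inl hr.ne')).div_const (1 - 2 * ε)).const_add 1
    refine HasDerivAt.congr_deriv this ?_
    rw [mul_div_assoc, mul_div_cancel₀ _ hd.ne']
    congr 1
    ring
  · intro r hr
    positivity
  · exact hW
  · intro r hr hr1
    rw [← Real.rpow_add hr, neg_add_cancel, Real.rpow_zero, mul_one]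
    have := hW r hr hr1
    gcongr
  · intro r hr hr1
    simp only [Real.rpow_zero, one_pow]
    have : 0 ≤ r ^ (1 - 2 * ε) / (1 - 2 * ε) := by positivity
    linarith

theorem lower_one (ε : ℝ) (hε2 : ε < 1/2) (u : ℝ → ℝ) (hf : wLinf ε u ≠ ⊤) :
    wL2 0 u ^ 2 ≤ ENNReal.ofReal (1 / (1 - 2 * ε)) * wLinf ε u ^ 2 := by
  have hd : 0 < 1 - 2 * ε := by linarith
  have hint : IntegrableOn (fun s : ℝ => s ^ (-(2 * ε))) (Set.Ioo 0 1) :=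
    (intervalIntegral.integrableOn_Ioo_rpow_iff one_pos).2 (by linarith)
  have hval : ∫⁻ s in Set.Ioo (0:ℝ) 1, ENNReal.ofReal (s ^ (-(2 * ε)))
      = ENNReal.ofReal (1 / (1 - 2 * ε)) := by
    rw [← ofReal_integral_eq_lintegral_ofReal hint]
    · congr 1
      rw [← integral_Ioc_eq_integral_Ioo, ← intervalIntegral.integral_of_le zero_le_one,
        integral_rpow (Or.inl (by linarith))]
      rw [Real.one_rpow, Real.zero_rpow (by linarith)]
      congr 1 <;> ring
    · filter_upwards [ae_restrict_mem measurableSet_Ioo] with x hx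
      exact Real.rpow_nonneg hx.1.le _
  rw [wL2_sq, ← hval, ← lintegral_mul_const' ]
  · apply setLIntegral_mono' measurableSet_Ioo
    intro s hs
    have h1 : ENNReal.ofReal (s ^ ε * ‖u s‖) ≤ wLinf ε u :=
      le_iSup (fun s : Set.Ioo (0:ℝ) 1 => ENNReal.ofReal ((s : ℝ) ^ ε * ‖u (s : ℝ)‖)) ⟨s, hs⟩
    calc ENNReal.ofReal (s ^ (2 * (0:ℝ)) * ‖u s‖ ^ 2)
        = ENNReal.ofReal (s ^ (-(2 * ε))) * ENNReal.ofReal (s ^ ε * ‖u s‖) ^ 2 := by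
          have := Real.rpow_nonneg hs.1.le ε
          rw [← ENNReal.ofReal_pow (by positivity),
            ← ENNReal.ofReal_mul (Real.rpow_nonneg hs.1.le _), mul_pow, ← mul_assoc]
          congr 2
          rw [← Real.rpow_natCast, ← Real.rpow_mul hs.1.le, ← Real.rpow_add hs.1]
          congr 1
          push_cast
          ring
      _ ≤ _ := by gcongr
  · exact ENNReal.pow_ne_top hf

/-- the equivalences `(NormEquiv)` for the norms `X^k_ε`, `k = 1,2,3`. -/
theorem stmt3 (ε : ℝ) (hε : ε ∈ Set.Ioo (0:ℝ) (1/2)) :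
    ∃ C : ℝ, 1 ≤ C ∧ ∀ u : ℝ → ℝ,
      ContDiffOn ℝ (⊤ : ℕ∞) u (Set.Ioi 0) →
      wL2 0 u ≠ ⊤ → wL2 0 (deriv u) ≠ ⊤ →
      wLinf ε u ≠ ⊤ → wLinf 0 u ≠ ⊤ → wLinf ε (deriv u) ≠ ⊤ →
      wL2 (1/2 + ε) (deriv u) ≠ ⊤ → wL2 ε (deriv u) ≠ ⊤ →
      wL2 (1 + ε) (iteratedDeriv 2 u) ≠ ⊤ → wL2 (1/2 + ε) (iteratedDeriv 2 u) ≠ ⊤ →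
      wL2 (3/2 + ε) (iteratedDeriv 3 u) ≠ ⊤ →
      -- k = 1
      (((ENNReal.ofReal C)⁻¹ * (wL2 0 u ^ 2 + wL2 (1/2 + ε) (deriv u) ^ 2) ≤
          wLinf ε u ^ 2 + wL2 (1/2 + ε) (deriv u) ^ 2 ∧
        wLinf ε u ^ 2 + wL2 (1/2 + ε) (deriv u) ^ 2 ≤
          ENNReal.ofReal C * (wL2 0 u ^ 2 + wL2 (1/2 + ε) (deriv u) ^ 2)) ∧
      -- k = 2
       ((ENNReal.ofReal C)⁻¹ *
            (wL2 0 u ^ 2 + wL2 ε (deriv u) ^ 2 + wL2 (1 + ε) (iteratedDeriv 2 u) ^ 2) ≤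
          wLinf 0 u ^ 2 + wL2 ε (deriv u) ^ 2 + wL2 (1 + ε) (iteratedDeriv 2 u) ^ 2 ∧
        wLinf 0 u ^ 2 + wL2 ε (deriv u) ^ 2 + wL2 (1 + ε) (iteratedDeriv 2 u) ^ 2 ≤
          ENNReal.ofReal C *
            (wL2 0 u ^ 2 + wL2 ε (deriv u) ^ 2 + wL2 (1 + ε) (iteratedDeriv 2 u) ^ 2)) ∧
      -- k = 3
       ((ENNReal.ofReal C)⁻¹ *
            ((wL2 0 u ^ 2 + wL2 0 (deriv u) ^ 2) + wL2 (1/2 + ε) (iteratedDeriv 2 u) ^ 2 +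
              wL2 (3/2 + ε) (iteratedDeriv 3 u) ^ 2) ≤
          wLinf 0 u ^ 2 + wLinf ε (deriv u) ^ 2 + wL2 (1/2 + ε) (iteratedDeriv 2 u) ^ 2 +
            wL2 (3/2 + ε) (iteratedDeriv 3 u) ^ 2 ∧
        wLinf 0 u ^ 2 + wLinf ε (deriv u) ^ 2 + wL2 (1/2 + ε) (iteratedDeriv 2 u) ^ 2 +
            wL2 (3/2 + ε) (iteratedDeriv 3 u) ^ 2 ≤
          ENNReal.ofReal C *
            ((wL2 0 u ^ 2 + wL2 0 (deriv u) ^ 2) + wL2 (1/2 + ε) (iteratedDeriv 2 u) ^ 2 +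
              wL2 (3/2 + ε) (iteratedDeriv 3 u) ^ 2))) := by
  obtain ⟨hε0, hε1⟩ := hε
  obtain ⟨K1, hK1, H1⟩ := upper_one ε hε0
  obtain ⟨K2, hK2, H2⟩ := upper_two ε hε0.le hε1
  obtain ⟨K3, hK3, H3⟩ := upper_two 0 le_rfl (by norm_num)
  have L1 := lower_one ε hε1
  have L2 := lower_one 0 (by norm_num)
  set K4 := 1 / (1 - 2 * ε) with hK4
  have hK4' : 0 ≤ K4 := by
    have : 0 < 1 - 2 * ε := by linarith
    positivity
  refine ⟨1 + K1 + K2 + K3 + K4, by linarith, ?_⟩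
  set C := 1 + K1 + K2 + K3 + K4 with hC
  intro u hu f1 f2 f3 f4 f5 f6 f7 f8 f9 f10
  have hu1 : ContDiffOn ℝ 1 u (Set.Ioi 0) := hu.of_le (by exact_mod_cast le_top)
  have hu2 : ContDiffOn ℝ 1 (deriv u) (Set.Ioi 0) :=
    hu.deriv_of_isOpen isOpen_Ioi (by
      have h : ((2 : ℕ∞) : WithTop ℕ∞) ≤ ((⊤ : ℕ∞) : WithTop ℕ∞) := WithTop.coe_le_coe.2 le_top
      norm_num
      exact h)
  have e2 : iteratedDeriv 2 u = deriv (deriv u) := by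
    rw [iteratedDeriv_succ, iteratedDeriv_one]
  rw [e2] at f8 f9
  simp only [e2]
  have a1 := H1 u hu1 f1 f6
  have a2 := H2 u hu1 f1 f7
  have a3 := H3 u hu1 f1 f2
  have a4 := H1 (deriv u) hu2 f2 f9
  have b1 := L1 u f3
  have b2 := L2 u f4
  have b3 := L1 (deriv u) f5
  clear H1 H2 H3 L1 L2
  have hC1 : 1 ≤ C := by linarith
  have hCpos : ENNReal.ofReal C ≠ 0 := by
    simp
    linarith
  simp only [ENNReal.inv_mul_le_iff hCpos ENNReal.ofReal_ne_top]
  have q : ∀ (x : ℝ≥0∞), x ≠ ⊤ → x ^ 2 ≠ ⊤ := fun x hx => ENNReal.pow_ne_top hx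
  replace f1 := q _ f1
  replace f2 := q _ f2
  replace f3 := q _ f3
  replace f4 := q _ f4
  replace f5 := q _ f5
  replace f6 := q _ f6
  replace f7 := q _ f7
  replace f8 := q _ f8
  replace f9 := q _ f9
  replace f10 := q _ f10
  clear q
  generalize wL2 0 u ^ 2 = x1 at *
  generalize wL2 0 (deriv u) ^ 2 = x2 at *
  generalize wLinf ε u ^ 2 = x3 at *
  generalize wLinf 0 u ^ 2 = x4 at *
  generalize wLinf ε (deriv u) ^ 2 = x5 at *
  generalize wL2 (1/2 + ε) (deriv u) ^ 2 = x6 at *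
  generalize wL2 ε (deriv u) ^ 2 = x7 at *
  generalize wL2 (1 + ε) (deriv (deriv u)) ^ 2 = x8 at *
  generalize wL2 (1/2 + ε) (deriv (deriv u)) ^ 2 = x9 at *
  generalize wL2 (3/2 + ε) (iteratedDeriv 3 u) ^ 2 = x10 at *
  have cv : ∀ (K : ℝ) (x : NNReal), ENNReal.ofReal K * (x : ℝ≥0∞) = ((K.toNNReal * x : NNReal) : ℝ≥0∞) := by
    intro K x
    rw [ENNReal.coe_mul]
    rfl
  lift x1 to NNReal using f1
  lift x2 to NNReal using f2
  lift x3 to NNReal using f3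
  lift x4 to NNReal using f4
  lift x5 to NNReal using f5
  lift x6 to NNReal using f6
  lift x7 to NNReal using f7
  lift x8 to NNReal using f8
  lift x9 to NNReal using f9
  lift x10 to NNReal using f10
  have hC0 : 0 ≤ C := by linarith
  have e0 : (1:ℝ) / (1 - 2 * 0) = 1 := by norm_num
  rw [e0] at b2
  simp only [← ENNReal.coe_add, cv, ENNReal.coe_le_coe, ← NNReal.coe_le_coe, NNReal.coe_mul,
    NNReal.coe_add, Real.coe_toNNReal _ hC0, Real.coe_toNNReal _ hK1, Real.coe_toNNReal _ hK2,
    Real.coe_toNNReal _ hK3, Real.coe_toNNReal _ hK4', Real.coe_toNNReal _ zero_le_one] at *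
  have p1 := x1.coe_nonneg
  have p2 := x2.coe_nonneg
  have p3 := x3.coe_nonneg
  have p4 := x4.coe_nonneg
  have p5 := x5.coe_nonneg
  have p6 := x6.coe_nonneg
  have p7 := x7.coe_nonneg
  have p8 := x8.coe_nonneg
  have p9 := x9.coe_nonneg
  have p10 := x10.coe_nonneg
  generalize (x1 : ℝ) = x1 at *
  generalize (x2 : ℝ) = x2 at *
  generalize (x3 : ℝ) = x3 at *
  generalize (x4 : ℝ) = x4 at *
  generalize (x5 : ℝ) = x5 at *
  generalize (x6 : ℝ) = x6 at *
  generalize (x7 : ℝ) = x7 at *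
  generalize (x8 : ℝ) = x8 at *
  generalize (x9 : ℝ) = x9 at *
  generalize (x10 : ℝ) = x10 at *
  have m : ∀ {K x : ℝ}, 0 ≤ K → 0 ≤ x → 0 ≤ K * x := fun h h' => mul_nonneg h h'
  have expand : ∀ x, C * x = x + K1 * x + K2 * x + K3 * x + K4 * x := by
    intro x
    rw [hC]
    ring
  simp only [expand]
  have n : ∀ x, 0 ≤ x → 0 ≤ K1 * x ∧ 0 ≤ K2 * x ∧ 0 ≤ K3 * x ∧ 0 ≤ K4 * x :=
    fun x hx => ⟨m hK1 hx, m hK2 hx, m hK3 hx, m hK4' hx⟩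
  simp only [mul_add] at *
  obtain ⟨_, _, _, _⟩ := n x1 p1
  obtain ⟨_, _, _, _⟩ := n x2 p2
  obtain ⟨_, _, _, _⟩ := n x3 p3
  obtain ⟨_, _, _, _⟩ := n x4 p4
  obtain ⟨_, _, _, _⟩ := n x5 p5
  obtain ⟨_, _, _, _⟩ := n x6 p6
  obtain ⟨_, _, _, _⟩ := n x7 p7
  obtain ⟨_, _, _, _⟩ := n x8 p8
  obtain ⟨_, _, _, _⟩ := n x9 p9
  obtain ⟨_, _, _, _⟩ := n x10 p10
  refine ⟨⟨?_, ?_⟩, ⟨?_, ?_⟩, ?_, ?_⟩ <;> linarith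
end
end

section
/- For every nonnegative integer m there exists a constant C = C(m) > 0 such that for all sufficiently smooth bounded functions u, v on (0,1] with finite X^m norms, the pointwise product uv satisfies the tame estimate ‖uv‖_{X^m} ≤ C ( ‖u‖_{L^∞(0,1)} ‖v‖_{X^m} + ‖v‖_{L^∞(0,1)} ‖u‖_{X^m} ). -/
open MeasureTheory ENNReal RealInnerProductSpace

noncomputable section

def Tower (p : ℕ → ℝ → ℝ) : Prop := ∀ i, ∀ t : ℝ, 0 < t → HasDerivAt (p i) (p (i+1) t) t

theorem Tower.contOn {p : ℕ → ℝ → ℝ} (hp : Tower p) (i : ℕ) : ContinuousOn (p i) (Set.Ioi 0) :=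
  fun t ht => (hp i t ht).continuousAt.continuousWithinAt

theorem Tower.contOn' {p : ℕ → ℝ → ℝ} (hp : Tower p) (i : ℕ) {x R : ℝ} (hx : 0 < x) :
    ContinuousOn (p i) (Set.Icc x R) :=
  (hp.contOn i).mono fun _ ht => lt_of_lt_of_le hx ht.1

theorem ii_of {f : ℝ → ℝ} (hf : ContinuousOn f (Set.Ioi 0)) {x R : ℝ} (hx : 0 < x) (hR : 0 < R) :
    IntervalIntegrable f volume x R := by
  apply ContinuousOn.intervalIntegrable
  apply hf.mono
  intro t ht
  rcases Set.mem_uIcc.1 ht with h | h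
  · exact lt_of_lt_of_le hx h.1
  · exact lt_of_lt_of_le hR h.1

/-- Cauchy-Schwarz -/
theorem cs_int {f g : ℝ → ℝ} (hf : ContinuousOn f (Set.Ioi 0)) (hg : ContinuousOn g (Set.Ioi 0))
    {x R : ℝ} (hx : 0 < x) (hxR : x ≤ R) :
    (∫ t in x..R, f t * g t) ^ 2 ≤ (∫ t in x..R, f t ^ 2) * (∫ t in x..R, g t ^ 2) := by
  have hR : 0 < R := hx.trans_le hxR
  have key : ∀ c : ℝ, 0 ≤ (∫ t in x..R, f t ^ 2) * (c * c) + (2 * ∫ t in x..R, f t * g t) * c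
      + (∫ t in x..R, g t ^ 2) := by
    intro c
    have h1 : (∫ t in x..R, (c * f t + g t) ^ 2) = (∫ t in x..R, f t ^ 2) * (c * c) +
        (2 * ∫ t in x..R, f t * g t) * c + (∫ t in x..R, g t ^ 2) := by
      have i1 : IntervalIntegrable (fun t => f t ^ 2 * (c * c)) volume x R :=
        ii_of (by fun_prop) hx hR
      have i2 : IntervalIntegrable (fun t => (f t * g t) * (2 * c)) volume x R :=
        ii_of (by fun_prop) hx hR
      have i3 : IntervalIntegrable (fun t => g t ^ 2) volume x R :=
        ii_of (by fun_prop) hx hR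
      have : (fun t => (c * f t + g t) ^ 2) =
          fun t => f t ^ 2 * (c * c) + (f t * g t) * (2 * c) + g t ^ 2 := by
        funext t; ring
      rw [this, intervalIntegral.integral_add (i1.add i2) i3, intervalIntegral.integral_add i1 i2,
        intervalIntegral.integral_mul_const, intervalIntegral.integral_mul_const]
      ring
    rw [← h1]
    exact intervalIntegral.integral_nonneg hxR fun t _ => sq_nonneg _
  have := discrim_le_zero key
  unfold discrim at this
  nlinarith

theorem int_mono {f g : ℝ → ℝ} (hf : ContinuousOn f (Set.Ioi 0)) (hg : ContinuousOn g (Set.Ioi 0))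
    {x R : ℝ} (hx : 0 < x) (hxR : x ≤ R) (h : ∀ t ∈ Set.Icc x R, f t ≤ g t) :
    (∫ t in x..R, f t) ≤ ∫ t in x..R, g t :=
  intervalIntegral.integral_mono_on hxR (ii_of hf hx (hx.trans_le hxR))
    (ii_of hg hx (hx.trans_le hxR)) h

theorem int_sub_mono {f : ℝ → ℝ} (hf : ContinuousOn f (Set.Ioi 0)) (h0 : ∀ t, 0 < t → 0 ≤ f t)
    {x y z w : ℝ} (hx : 0 < x) (hxy : x ≤ y) (hyz : y ≤ z) (hzw : z ≤ w) :
    (∫ t in y..z, f t) ≤ ∫ t in x..w, f t := by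
  have hy := hx.trans_le hxy
  have hz := hy.trans_le hyz
  have hw := hz.trans_le hzw
  have e1 := intervalIntegral.integral_add_adjacent_intervals (ii_of hf hx hy) (ii_of hf hy hz)
  have e2 := intervalIntegral.integral_add_adjacent_intervals (ii_of hf hx hz) (ii_of hf hz hw)
  have n1 : 0 ≤ ∫ t in x..y, f t :=
    intervalIntegral.integral_nonneg hxy fun t ht => h0 t (hx.trans_le ht.1)
  have n2 : 0 ≤ ∫ t in z..w, f t :=
    intervalIntegral.integral_nonneg hzw fun t ht => h0 t (hz.trans_le ht.1)
  linarith

/-- a point where the derivative is controlled -/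
theorem exists_pt (a : ℕ) : ∃ C : ℝ, 0 ≤ C ∧ ∀ p, Tower p → ∀ x R : ℝ, 0 < x → x < R →
    ∃ ξ ∈ Set.Icc x R, (R - x) ^ (a+1) * |p a ξ| ≤ C * ∫ t in x..R, |p 0 t| := by
  induction a with
  | zero =>
    refine ⟨1, zero_le_one, fun p hp x R hx hxR => ?_⟩
    have hc : ContinuousOn (fun t => |p 0 t|) (Set.Ioi 0) := (hp.contOn 0).abs
    obtain ⟨ξ, hξ, hmin⟩ := isCompact_Icc.exists_isMinOn (Set.nonempty_Icc.2 hxR.le)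
      (hp.contOn' 0 hx (R := R)).abs
    refine ⟨ξ, hξ, ?_⟩
    have := int_mono (f := fun _ => |p 0 ξ|) continuousOn_const hc hx hxR.le (fun t ht => hmin ht)
    simp only [intervalIntegral.integral_const, smul_eq_mul] at this
    simpa using this
  | succ a ih =>
    obtain ⟨C, hC, ih⟩ := ih
    refine ⟨2 * C * 3 ^ (a+2), by positivity, fun p hp x R hx hxR => ?_⟩
    have hc : ContinuousOn (fun t => |p 0 t|) (Set.Ioi 0) := (hp.contOn 0).abs
    set l := (R - x) / 3 with hl
    have hl0 : 0 < l := by rw [hl]; linarith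
    have hR : R = x + 3 * l := by rw [hl]; ring
    obtain ⟨ξ, hξ, h1⟩ := ih p hp x (x + l) hx (by linarith)
    obtain ⟨η, hη, h2⟩ := ih p hp (x + 2 * l) R (by linarith) (by linarith)
    have m1 := int_sub_mono hc (fun _ _ => abs_nonneg _) hx le_rfl (by linarith : x ≤ x + l)
      (by linarith : x + l ≤ R)
    have m2 := int_sub_mono hc (fun _ _ => abs_nonneg _) hx (by linarith : x ≤ x + 2 * l)
      (by linarith : x + 2 * l ≤ R) le_rfl
    have hlt : ξ < η := by linarith [hξ.2, hη.1]
    have hξ0 : 0 < ξ := hx.trans_le hξ.1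
    obtain ⟨c, hc, hc2⟩ := exists_hasDerivAt_eq_slope (p a) (p (a+1)) hlt
      (hp.contOn' a hξ0) (fun t ht => hp a t (hξ0.trans ht.1))
    refine ⟨c, ⟨hξ.1.trans hc.1.le, hc.2.le.trans hη.2⟩, ?_⟩
    set I := ∫ t in x..R, |p 0 t|
    have e1 : x + l - x = l := by ring
    have e2 : R - (x + 2 * l) = l := by rw [hR]; ring
    rw [e1] at h1
    rw [e2] at h2
    have h3 : |p (a+1) c| * (η - ξ) ≤ |p a η| + |p a ξ| := by
      rw [hc2, abs_div, abs_of_pos (sub_pos.2 hlt), div_mul_cancel₀ _ (sub_pos.2 hlt).ne']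
      exact abs_sub _ _
    have h4 : |p (a+1) c| * l ≤ |p a η| + |p a ξ| :=
      le_trans (mul_le_mul_of_nonneg_left (by linarith [hξ.2, hη.1]) (abs_nonneg _)) h3
    have h5 : l ^ (a+1) * (|p (a+1) c| * l) ≤ 2 * C * I := by
      have := mul_le_mul_of_nonneg_left h4 (pow_nonneg hl0.le (a+1))
      nlinarith [mul_le_mul_of_nonneg_left m1 hC, mul_le_mul_of_nonneg_left m2 hC]
    have e3 : R - x = 3 * l := by rw [hR]; ring
    rw [e3]
    calc (3 * l) ^ (a + 1 + 1) * |p (a+1) c| = 3 ^ (a+2) * (l ^ (a+1) * (|p (a+1) c| * l)) := by ring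
      _ ≤ 3 ^ (a+2) * (2 * C * I) := by gcongr
      _ = _ := by ring

theorem lemA_aux (k : ℕ) : ∀ a : ℕ, ∃ C : ℝ, 0 ≤ C ∧ ∀ p, Tower p → ∀ x R : ℝ, 0 < x → x < R →
    ∀ y ∈ Set.Icc x R, (R - x) ^ (a+1) * |p a y| ≤
      C * ((∫ t in x..R, |p 0 t|) + (R - x) ^ (a+1+k) * ∫ t in x..R, |p (a+1+k) t|) := by
  induction k with
  | zero =>
    intro a
    obtain ⟨C, hC, h⟩ := exists_pt a
    refine ⟨C + 1, by positivity, fun p hp x R hx hxR y hy => ?_⟩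
    obtain ⟨ξ, hξ, h1⟩ := h p hp x R hx hxR
    have hR := hx.trans hxR
    have hc : ContinuousOn (fun t => |p (a+1) t|) (Set.Ioi 0) := (hp.contOn _).abs
    have hξ0 : 0 < ξ := hx.trans_le hξ.1
    have hy0 : 0 < y := hx.trans_le hy.1
    have ftc : ∫ t in ξ..y, p (a+1) t = p a y - p a ξ := by
      apply intervalIntegral.integral_eq_sub_of_hasDerivAt
      · intro t ht
        apply hp
        rcases Set.mem_uIcc.1 ht with h | h
        · exact lt_of_lt_of_le hξ0 h.1
        · exact lt_of_lt_of_le hy0 h.1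
      · exact ii_of (hp.contOn _) hξ0 hy0
    have b : |p a y - p a ξ| ≤ ∫ t in x..R, |p (a+1) t| := by
      rw [← ftc]
      rcases le_total ξ y with h | h
      · exact (intervalIntegral.abs_integral_le_integral_abs h).trans
          (int_sub_mono hc (fun _ _ => abs_nonneg _) hx hξ.1 h hy.2)
      · rw [intervalIntegral.integral_symm, abs_neg]
        exact (intervalIntegral.abs_integral_le_integral_abs h).trans
          (int_sub_mono hc (fun _ _ => abs_nonneg _) hx hy.1 h hξ.2)
    have b2 : |p a y| ≤ |p a ξ| + ∫ t in x..R, |p (a+1) t| := by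
      have := abs_sub_abs_le_abs_sub (p a y) (p a ξ)
      linarith
    have n0 : 0 ≤ ∫ t in x..R, |p 0 t| :=
      intervalIntegral.integral_nonneg hxR.le fun t _ => abs_nonneg _
    have n1 : 0 ≤ ∫ t in x..R, |p (a+1) t| :=
      intervalIntegral.integral_nonneg hxR.le fun t _ => abs_nonneg _
    have hpow : 0 ≤ (R - x) ^ (a+1) := pow_nonneg (by linarith) _
    have := mul_le_mul_of_nonneg_left b2 hpow
    simp only [add_zero]
    nlinarith [mul_nonneg hC (mul_nonneg hpow n1)]
  | succ k ih =>
    intro a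
    obtain ⟨C, hC, h⟩ := exists_pt a
    obtain ⟨D, hD, ih⟩ := ih (a+1)
    refine ⟨C + D, by positivity, fun p hp x R hx hxR y hy => ?_⟩
    obtain ⟨ξ, hξ, h1⟩ := h p hp x R hx hxR
    have e : a + 1 + 1 + k = a + 1 + (k+1) := by ring
    have ih' := ih p hp x R hx hxR
    rw [e] at ih'
    set I := ∫ t in x..R, |p 0 t|
    set J := (R - x) ^ (a+1+(k+1)) * ∫ t in x..R, |p (a+1+(k+1)) t|
    have n0 : 0 ≤ I :=
      intervalIntegral.integral_nonneg hxR.le fun t _ => abs_nonneg _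
    have hl : 0 < R - x := by linarith
    have n1 : 0 ≤ J :=
      mul_nonneg (pow_nonneg hl.le _)
        (intervalIntegral.integral_nonneg hxR.le fun t _ => abs_nonneg _)
    have b : (R - x) ^ (a+1) * |p a y - p a ξ| ≤ D * (I + J) := by
      have := Convex.norm_image_sub_le_of_norm_hasDerivWithin_le (f := p a) (f' := p (a+1))
        (s := Set.Icc x R) (x := ξ) (y := y) (C := D * (I + J) / (R - x) ^ (a+1+1))
        (fun t ht => (hp a t (hx.trans_le ht.1)).hasDerivWithinAt)
        (fun t ht => by
          rw [le_div_iff₀ (by positivity), Real.norm_eq_abs, mul_comm]; exact ih' t ht)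
        (convex_Icc _ _) hξ hy
      rw [Real.norm_eq_abs, Real.norm_eq_abs] at this
      have h2 : |y - ξ| ≤ R - x := abs_le.2 ⟨by linarith [hy.1, hξ.2], by linarith [hy.2, hξ.1]⟩
      calc (R - x) ^ (a+1) * |p a y - p a ξ|
          ≤ (R - x) ^ (a+1) * (D * (I + J) / (R - x) ^ (a+1+1) * (R - x)) := by
            gcongr
            refine this.trans ?_
            gcongr
        _ = D * (I + J) := by rw [pow_succ (R - x) (a+1)]; field_simp
    have b2 : |p a y| ≤ |p a ξ| + |p a y - p a ξ| := by
      have := abs_sub_abs_le_abs_sub (p a y) (p a ξ)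
      linarith
    have := mul_le_mul_of_nonneg_left b2 (pow_nonneg hl.le (a+1))
    nlinarith [mul_nonneg hC n1]

theorem unif {P : ℕ → ℝ → Prop} (mono : ∀ a C D, C ≤ D → P a C → P a D) (m : ℕ)
    (h : ∀ a < m, ∃ C, 0 ≤ C ∧ P a C) : ∃ C, 0 ≤ C ∧ ∀ a < m, P a C := by
  induction m with
  | zero => exact ⟨0, le_rfl, fun a ha => absurd ha (by omega)⟩
  | succ m ih =>
    obtain ⟨C, hC, h1⟩ := ih fun a ha => h a (by omega)
    obtain ⟨D, hD, h2⟩ := h m (by omega)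
    refine ⟨C + D, by positivity, fun a ha => ?_⟩
    rcases Nat.lt_succ_iff_lt_or_eq.1 ha with h | h
    · exact mono a _ _ (by linarith) (h1 a h)
    · subst h; exact mono _ _ _ (by linarith) h2

theorem lemA (m : ℕ) : ∃ C : ℝ, 0 ≤ C ∧ ∀ a < m, ∀ p, Tower p → ∀ x R : ℝ, 0 < x → x < R →
    ∀ y ∈ Set.Icc x R, (R - x) ^ (a+1) * |p a y| ≤
      C * ((∫ t in x..R, |p 0 t|) + (R - x) ^ m * ∫ t in x..R, |p m t|) := by
  apply unif
  · intro a C D hCD h p hp x R hx hxR y hy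
    refine (h p hp x R hx hxR y hy).trans ?_
    have n0 : 0 ≤ ∫ t in x..R, |p 0 t| :=
      intervalIntegral.integral_nonneg hxR.le fun t _ => abs_nonneg _
    have n1 : 0 ≤ ∫ t in x..R, |p m t| :=
      intervalIntegral.integral_nonneg hxR.le fun t _ => abs_nonneg _
    have : 0 ≤ R - x := by linarith
    gcongr
  · intro a ha
    obtain ⟨k, rfl⟩ := Nat.exists_eq_add_of_lt ha
    have := lemA_aux k a
    rwa [show a + k + 1 = a + 1 + k by ring]

theorem le_of_sq {a b : ℝ} (hb : 0 ≤ b) (h : a ^ 2 ≤ b ^ 2) : a ≤ b :=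
  (le_abs_self a).trans (abs_le_of_sq_le_sq h hb)

theorem endpt (m : ℕ) : ∃ C : ℝ, 0 ≤ C ∧ ∀ a < m, ∀ p, Tower p → ∀ x R A : ℝ, 0 < x → x < R →
    0 ≤ A → (∫ t in x..R, p 0 t ^ 2) ≤ A ^ 2 * (R - x) →
    (R - x) ^ (2 * m) * (∫ t in x..R, t ^ m * p m t ^ 2) ≤ A ^ 2 * R ^ m * (R - x) →
    (R - x) ^ a * |p a R| ≤ C * A := by
  obtain ⟨C, hC, h⟩ := lemA m
  refine ⟨2 ^ m * (C * (2 + 2 ^ (m+1))), by positivity, fun a ha p hp x R A hx hxR hA h0 hm => ?_⟩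
  obtain ⟨l, hl⟩ : ∃ l, l = (R - x) / 2 := ⟨_, rfl⟩
  have hl0 : 0 < l := by rw [hl]; linarith
  have e : R - x = 2 * l := by rw [hl]; ring
  rw [e] at h0 hm ⊢
  have hR : 0 < R := hx.trans hxR
  have hx' : 0 < R - l := by linarith
  have hx'R : R - l ≤ R := by linarith
  have c0 := hp.contOn 0
  have cm := hp.contOn m
  have hh := h a ha p hp (R - l) R hx' (by linarith) R ⟨hx'R, le_rfl⟩
  rw [_root_.sub_sub_cancel] at hh
  have b0 : (∫ t in (R-l)..R, |p 0 t|) ≤ 2 * A * l := by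
    apply le_of_sq (by positivity)
    have := cs_int (f := fun t => |p 0 t|) (g := fun _ => 1) c0.abs continuousOn_const hx' hx'R
    simp only [mul_one, sq_abs, one_pow, intervalIntegral.integral_const, smul_eq_mul,
      _root_.sub_sub_cancel] at this
    have m0 := int_sub_mono (f := fun t => p 0 t ^ 2) (c0.pow 2) (fun _ _ => sq_nonneg _) hx
      (by linarith : x ≤ R - l) hx'R le_rfl
    calc _ ≤ _ := this
      _ ≤ (A ^ 2 * (2 * l)) * l := by gcongr; exact m0.trans h0
      _ ≤ (2 * A * l) ^ 2 := by nlinarith [mul_nonneg (sq_nonneg A) (sq_nonneg l)]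
  have bm : l ^ m * (∫ t in (R-l)..R, |p m t|) ≤ 2 ^ (m+1) * A * l := by
    apply le_of_sq (by positivity)
    have := cs_int (f := fun t => |p m t|) (g := fun _ => 1) cm.abs continuousOn_const hx' hx'R
    simp only [mul_one, sq_abs, one_pow, intervalIntegral.integral_const, smul_eq_mul,
      _root_.sub_sub_cancel] at this
    have m0 := int_sub_mono (f := fun t => t ^ m * p m t ^ 2) (by fun_prop)
      (fun t ht => by positivity) hx (by linarith : x ≤ R - l) hx'R le_rfl
    have m1 := int_mono (f := fun t => R ^ m * p m t ^ 2) (g := fun t => 2 ^ m * (t ^ m * p m t ^ 2))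
      (by fun_prop) (by fun_prop) hx' hx'R (fun t ht => by
        rw [← mul_assoc, ← mul_pow]
        have : R ≤ 2 * t := by linarith [ht.1]
        gcongr)
    rw [intervalIntegral.integral_const_mul, intervalIntegral.integral_const_mul] at m1
    set G := ∫ t in x..R, t ^ m * p m t ^ 2
    set P := ∫ t in (R-l)..R, p m t ^ 2
    have hP : 0 ≤ P := intervalIntegral.integral_nonneg hx'R fun t _ => sq_nonneg _
    have k1 : R ^ m * P ≤ 2 ^ m * G := m1.trans (by gcongr)
    have k2 : R ^ m * ((2 * l) ^ (2 * m) * P) ≤ R ^ m * (2 ^ m * A ^ 2 * (2 * l)) := by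
      calc _ = (2 * l) ^ (2 * m) * (R ^ m * P) := by ring
        _ ≤ (2 * l) ^ (2 * m) * (2 ^ m * G) := by gcongr
        _ = 2 ^ m * ((2 * l) ^ (2 * m) * G) := by ring
        _ ≤ 2 ^ m * (A ^ 2 * R ^ m * (2 * l)) := by gcongr
        _ = _ := by ring
    have k3 := le_of_mul_le_mul_left k2 (by positivity)
    calc _ = l ^ (2 * m) * (∫ t in (R-l)..R, |p m t|) ^ 2 := by ring
      _ ≤ l ^ (2 * m) * (P * l) := by gcongr
      _ ≤ (2 * l) ^ (2 * m) * (P * l) := by gcongr; linarith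
      _ = ((2 * l) ^ (2 * m) * P) * l := by ring
      _ ≤ (2 ^ m * A ^ 2 * (2 * l)) * l := by gcongr
      _ = 2 ^ (m+1) * (A * l) ^ 2 := by ring
      _ ≤ (2 ^ (m+1)) ^ 2 * (A * l) ^ 2 := by
        gcongr
        rw [← pow_mul]
        exact pow_le_pow_right₀ (by norm_num) (by omega)
      _ = _ := by ring
  have k4 : l * (l ^ a * |p a R|) ≤ l * (C * (2 + 2 ^ (m+1)) * A) := by
    calc _ = l ^ (a+1) * |p a R| := by ring
      _ ≤ _ := hh
      _ ≤ C * (2 * A * l + 2 ^ (m+1) * A * l) := by gcongr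
      _ = _ := by ring
  have k5 := le_of_mul_le_mul_left k4 hl0
  calc (2 * l) ^ a * |p a R| = 2 ^ a * (l ^ a * |p a R|) := by ring
    _ ≤ 2 ^ m * (C * (2 + 2 ^ (m+1)) * A) := by
      gcongr
      norm_num
    _ = _ := by ring

theorem wint (a : ℕ) {y R : ℝ} (hy : 0 < y) (hyR : y ≤ R) :
    y ^ (a+1) * R * (∫ t in y..R, (t ^ (a+1+1))⁻¹) ≤ R - y := by
  have hR : 0 < R := hy.trans_le hyR
  have c1 : ContinuousOn (fun t : ℝ => (t ^ 2)⁻¹) (Set.Ioi 0) :=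
    ContinuousOn.inv₀ (by fun_prop) (fun t (ht : 0 < t) => by positivity)
  have c2 : ContinuousOn (fun t : ℝ => (t ^ (a+1+1))⁻¹) (Set.Ioi 0) :=
    ContinuousOn.inv₀ (by fun_prop) (fun t (ht : 0 < t) => by positivity)
  have h1 := int_mono (f := fun t => y ^ a * (t ^ (a+1+1))⁻¹) (g := fun t => (t ^ 2)⁻¹)
    (by fun_prop) c1 hy hyR (fun t ht => by
      have ht0 : 0 < t := hy.trans_le ht.1
      have : y ^ a ≤ t ^ a := pow_le_pow_left₀ hy.le ht.1 a
      rw [show t ^ (a+1+1) = t ^ a * t ^ 2 by ring, mul_inv, ← mul_assoc]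
      have : y ^ a * (t ^ a)⁻¹ ≤ 1 := by
        rw [mul_inv_le_iff₀ (by positivity)]; linarith
      have h2 : 0 ≤ (t ^ 2)⁻¹ := by positivity
      nlinarith)
  have ftc : ∫ t in y..R, (t ^ 2)⁻¹ = -R⁻¹ - -y⁻¹ := by
    apply intervalIntegral.integral_eq_sub_of_hasDerivAt (f := fun t => -t⁻¹)
    · intro t ht
      rw [Set.uIcc_of_le hyR] at ht
      have h3 := (hasDerivAt_inv (hy.trans_le ht.1).ne').fun_neg
      rwa [neg_neg] at h3
    · exact ii_of c1 hy hR
  rw [intervalIntegral.integral_const_mul, ftc] at h1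
  calc _ = y * R * (y ^ a * (∫ t in y..R, (t ^ (a+1+1))⁻¹)) := by ring
    _ ≤ y * R * (-R⁻¹ - -y⁻¹) := by gcongr
    _ = R - y := by field_simp; ring

theorem supL_aux (m : ℕ) (k : ℕ) : ∃ C : ℝ, 0 ≤ C ∧ ∀ a, 1 ≤ a → a + 1 + k = m → ∀ p, Tower p →
    ∀ x R A : ℝ, 0 < x → x < R →
    0 ≤ A → (∫ t in x..R, p 0 t ^ 2) ≤ A ^ 2 * (R - x) →
    (R - x) ^ (2 * m) * (∫ t in x..R, t ^ m * p m t ^ 2) ≤ A ^ 2 * R ^ m * (R - x) →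
    ∀ y ∈ Set.Icc x R, √y ^ a * |p a y| * (R - x) ^ a ≤ C * A * √R ^ a := by
  obtain ⟨D, hD, hend⟩ := endpt m
  induction k with
  | zero =>
    refine ⟨D + 1, by positivity, fun a ha hm p hp x R A hx hxR hA h0 hGm y hy => ?_⟩
    have he := hend a (by omega) p hp x R A hx hxR hA h0 hGm
    obtain ⟨b, rfl⟩ : ∃ b, a = b + 1 := ⟨a - 1, by omega⟩
    simp only [add_zero] at hm
    subst hm
    have hR : 0 < R := hx.trans hxR
    have hy0 : 0 < y := hx.trans_le hy.1
    have hl : 0 < R - x := by linarith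
    have ftc : ∫ t in y..R, p (b+1+1) t = p (b+1) R - p (b+1) y := by
      apply intervalIntegral.integral_eq_sub_of_hasDerivAt
      · intro t ht
        rw [Set.uIcc_of_le hy.2] at ht
        exact hp _ t (hy0.trans_le ht.1)
      · exact ii_of (hp.contOn _) hy0 hR
    have cm := hp.contOn (b+1+1)
    have csq : ContinuousOn (fun t => (√t ^ (b+1+1))⁻¹) (Set.Ioi 0) :=
      ContinuousOn.inv₀ (by fun_prop) (fun t (ht : 0 < t) => by positivity)
    have cs := cs_int (f := fun t => √t ^ (b+1+1) * |p (b+1+1) t|) (g := fun t => (√t ^ (b+1+1))⁻¹)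
      (by fun_prop) csq hy0 hy.2
    have r1 : ∫ t in y..R, (√t ^ (b+1+1) * |p (b+1+1) t|) * (√t ^ (b+1+1))⁻¹ =
        ∫ t in y..R, |p (b+1+1) t| := by
      apply intervalIntegral.integral_congr
      intro t ht
      rw [Set.uIcc_of_le hy.2] at ht
      have : 0 < t := hy0.trans_le ht.1
      simp only
      field_simp
    have r2 : ∫ t in y..R, (√t ^ (b+1+1) * |p (b+1+1) t|) ^ 2 =
        ∫ t in y..R, t ^ (b+1+1) * p (b+1+1) t ^ 2 := by
      apply intervalIntegral.integral_congr
      intro t ht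
      rw [Set.uIcc_of_le hy.2] at ht
      have : 0 < t := hy0.trans_le ht.1
      simp only
      rw [mul_pow, sq_abs, ← pow_mul, mul_comm _ 2, pow_mul, Real.sq_sqrt this.le]
    have r3 : ∫ t in y..R, ((√t ^ (b+1+1))⁻¹) ^ 2 = ∫ t in y..R, (t ^ (b+1+1))⁻¹ := by
      apply intervalIntegral.integral_congr
      intro t ht
      rw [Set.uIcc_of_le hy.2] at ht
      have : 0 < t := hy0.trans_le ht.1
      simp only
      rw [inv_pow, ← pow_mul, mul_comm _ 2, pow_mul, Real.sq_sqrt this.le]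
    rw [r1, r2, r3] at cs
    have hw := wint b hy0 hy.2
    have m0 := int_sub_mono (f := fun t => t ^ (b+1+1) * p (b+1+1) t ^ 2) (by fun_prop)
      (fun t ht => by positivity) hx hy.1 hy.2 le_rfl
    have b1 : |p (b+1) y| ≤ |p (b+1) R| + ∫ t in y..R, |p (b+1+1) t| := by
      have h1 := intervalIntegral.abs_integral_le_integral_abs (f := p (b+1+1)) (μ := volume) hy.2
      rw [ftc] at h1
      have := abs_sub_abs_le_abs_sub (p (b+1) y) (p (b+1) R)
      rw [abs_sub_comm] at this
      linarith
    have nS : 0 ≤ ∫ t in y..R, |p (b+1+1) t| :=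
      intervalIntegral.integral_nonneg hy.2 fun t _ => abs_nonneg _
    have nW : 0 ≤ ∫ t in y..R, (t ^ (b+1+1))⁻¹ :=
      intervalIntegral.integral_nonneg hy.2 fun t ht => by
        have : 0 < t := hy0.trans_le ht.1
        positivity
    have nG : 0 ≤ ∫ t in y..R, t ^ (b+1+1) * p (b+1+1) t ^ 2 :=
      intervalIntegral.integral_nonneg hy.2 fun t ht => by
        have : 0 < t := hy0.trans_le ht.1
        positivity
    generalize (∫ t in y..R, |p (b+1+1) t|) = S at *
    generalize (∫ t in y..R, (t ^ (b+1+1))⁻¹) = W at *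
    generalize (∫ t in y..R, t ^ (b+1+1) * p (b+1+1) t ^ 2) = G' at *
    generalize (∫ t in x..R, t ^ (b+1+1) * p (b+1+1) t ^ 2) = G at *
    have hyx : R - y ≤ R - x := by linarith [hy.1]
    generalize R - x = l at *
    have b2 : √y ^ (b+1) * S * l ^ (b+1) ≤ A * √R ^ (b+1) := by
      apply le_of_sq (by positivity)
      have e1 : (√y ^ (b+1) * S * l ^ (b+1)) ^ 2 = y ^ (b+1) * S ^ 2 * l ^ (2 * (b+1)) := by
        rw [mul_pow, mul_pow, ← pow_mul, mul_comm (b+1) 2, pow_mul, Real.sq_sqrt hy0.le, ← pow_mul,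
          mul_comm (b+1) 2]
      have e2 : (A * √R ^ (b+1)) ^ 2 = A ^ 2 * R ^ (b+1) := by
        rw [mul_pow, ← pow_mul, mul_comm (b+1) 2, pow_mul, Real.sq_sqrt hR.le]
      rw [e1, e2]
      have : (R * l ^ 2) * (y ^ (b+1) * S ^ 2 * l ^ (2 * (b+1))) ≤ (R * l ^ 2) * (A ^ 2 * R ^ (b+1)) := by
        calc _ = (y ^ (b+1) * R) * l ^ (2 * (b+1+1)) * S ^ 2 := by ring
          _ ≤ (y ^ (b+1) * R) * l ^ (2 * (b+1+1)) * (G' * W) := by gcongr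
          _ = (y ^ (b+1) * R * W) * (l ^ (2 * (b+1+1)) * G') := by ring
          _ ≤ l * (l ^ (2 * (b+1+1)) * G) := by gcongr; exact hw.trans hyx
          _ ≤ l * (A ^ 2 * R ^ (b+1+1) * l) := by gcongr
          _ = _ := by ring
      exact le_of_mul_le_mul_left this (by positivity)
    have b3 : √y ^ (b+1) ≤ √R ^ (b+1) := pow_le_pow_left₀ (Real.sqrt_nonneg _) (Real.sqrt_le_sqrt hy.2) _
    calc _ ≤ √y ^ (b+1) * (|p (b+1) R| + S) * l ^ (b+1) := by gcongr
      _ = √y ^ (b+1) * (l ^ (b+1) * |p (b+1) R|) + √y ^ (b+1) * S * l ^ (b+1) := by ring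
      _ ≤ √R ^ (b+1) * (D * A) + A * √R ^ (b+1) := by gcongr
      _ = _ := by ring
  | succ k ih =>
    obtain ⟨E, hE, ih⟩ := ih
    refine ⟨D + 2 * E, by positivity, fun a ha hm p hp x R A hx hxR hA h0 hGm y hy => ?_⟩
    have he := hend a (by omega) p hp x R A hx hxR hA h0 hGm
    have ih := ih (a+1) (by omega) (by omega) p hp x R A hx hxR hA h0 hGm
    have hR : 0 < R := hx.trans hxR
    have hy0 : 0 < y := hx.trans_le hy.1
    have hl : 0 < R - x := by linarith
    have b3 : √y ^ a ≤ √R ^ a := pow_le_pow_left₀ (Real.sqrt_nonneg _) (Real.sqrt_le_sqrt hy.2) _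
    rcases hy.2.eq_or_lt with h | hyR
    · subst h
      calc _ = √y ^ a * ((y - x) ^ a * |p a y|) := by ring
        _ ≤ √y ^ a * (D * A) := by gcongr
        _ ≤ √y ^ a * ((D + 2 * E) * A) := by gcongr; linarith
        _ = _ := by ring
    · obtain ⟨c, hc, hc2⟩ := exists_ratio_hasDerivAt_eq_ratio_slope (p a) (p (a+1)) hyR
        (hp.contOn' a hy0) (fun t ht => hp a t (hy0.trans ht.1)) (fun t => √t)
        (fun t => 1 / (2 * √t)) (by fun_prop)
        (fun t ht => Real.hasDerivAt_sqrt (hy0.trans ht.1).ne')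
      have hc0 : 0 < c := hy0.trans hc.1
      have ihc := ih c ⟨hy.1.trans hc.1.le, hc.2.le⟩
      have hsc : 0 < √c := Real.sqrt_pos.2 hc0
      have hsR : 0 < √R := Real.sqrt_pos.2 hR
      have hsy : 0 < √y := Real.sqrt_pos.2 hy0
      have e1 : p a R - p a y = 2 * (√R - √y) * (√c * p (a+1) c) := by
        field_simp at hc2
        linarith
      have hyc : √y ^ a ≤ √c ^ a := pow_le_pow_left₀ hsy.le (Real.sqrt_le_sqrt hc.1.le) _
      have e2 : 0 ≤ √R - √y := sub_nonneg.2 (Real.sqrt_le_sqrt hy.2)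
      have e3 : (√R - √y) * √R ≤ R - x := by
        have h1 := Real.sq_sqrt hR.le
        have h2 := Real.sq_sqrt hy0.le
        nlinarith [hy.1]
      have e4 : |p a R - p a y| = 2 * (√R - √y) * (√c * |p (a+1) c|) := by
        rw [e1, abs_mul, abs_mul √c, abs_of_pos hsc, abs_of_nonneg (by positivity)]
      have b1 : |p a y| ≤ |p a R| + |p a R - p a y| := by
        have := abs_sub_abs_le_abs_sub (p a y) (p a R)
        rw [abs_sub_comm] at this
        linarith
      generalize R - x = l at *
      have b2 : √y ^ a * |p a R - p a y| * l ^ a ≤ 2 * E * A * √R ^ a := by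
        have : (l * √R) * (√y ^ a * |p a R - p a y| * l ^ a) ≤ (l * √R) * (2 * E * A * √R ^ a) := by
          rw [e4]
          calc _ = 2 * √y ^ a * ((√R - √y) * √R) * (√c * |p (a+1) c|) * l ^ (a+1) := by ring
            _ ≤ 2 * √c ^ a * l * (√c * |p (a+1) c|) * l ^ (a+1) := by gcongr
            _ = 2 * l * (√c ^ (a+1) * |p (a+1) c| * l ^ (a+1)) := by ring
            _ ≤ 2 * l * (E * A * √R ^ (a+1)) := by gcongr
            _ = _ := by ring
        exact le_of_mul_le_mul_left this (by positivity)
      calc _ ≤ √y ^ a * (|p a R| + |p a R - p a y|) * l ^ a := by gcongr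
        _ = √y ^ a * (l ^ a * |p a R|) + √y ^ a * |p a R - p a y| * l ^ a := by ring
        _ ≤ √R ^ a * (D * A) + 2 * E * A * √R ^ a := by gcongr
        _ = _ := by ring

theorem supL (m : ℕ) : ∃ C : ℝ, 0 ≤ C ∧ ∀ a < m, 1 ≤ a → ∀ p, Tower p →
    ∀ x R A : ℝ, 0 < x → x < R →
    0 ≤ A → (∫ t in x..R, p 0 t ^ 2) ≤ A ^ 2 * (R - x) →
    (R - x) ^ (2 * m) * (∫ t in x..R, t ^ m * p m t ^ 2) ≤ A ^ 2 * R ^ m * (R - x) →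
    ∀ y ∈ Set.Icc x R, √y ^ a * |p a y| * (R - x) ^ a ≤ C * A * √R ^ a := by
  apply unif
  · intro a C D hCD h h1 p hp x R A hx hxR hA h2 h3 y hy
    refine (h h1 p hp x R A hx hxR hA h2 h3 y hy).trans ?_
    gcongr
  · intro a ha
    obtain ⟨C, hC, h⟩ := supL_aux m (m - 1 - a)
    exact ⟨C, hC, fun h1 => h a h1 (by omega)⟩

theorem hardy {f f' : ℝ → ℝ} (hf : ∀ t, 0 < t → HasDerivAt f (f' t) t)
    (hf' : ContinuousOn f' (Set.Ioi 0)) (k : ℕ) {δ : ℝ} (hδ : 0 < δ) (hδ1 : δ ≤ 1) :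
    (∫ t in δ..1, t ^ k * f t ^ 2) ≤ 2 * f 1 ^ 2 + 4 * ∫ t in δ..1, t ^ (k+2) * f' t ^ 2 := by
  have cf : ContinuousOn f (Set.Ioi 0) :=
    fun t ht => (hf t ht).continuousAt.continuousWithinAt
  have ftc : ∫ t in δ..1, ((k+1 : ℕ) * t ^ k * f t ^ 2 + t ^ (k+1) * (2 * f t * f' t)) =
      1 ^ (k+1) * f 1 ^ 2 - δ ^ (k+1) * f δ ^ 2 := by
    apply intervalIntegral.integral_eq_sub_of_hasDerivAt (f := fun t => t ^ (k+1) * f t ^ 2)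
    · intro t ht
      rw [Set.uIcc_of_le hδ1] at ht
      have h1 := (hasDerivAt_pow (k+1) t).mul ((hf t (hδ.trans_le ht.1)).pow 2)
      exact h1.congr_deriv (by simp)
    · exact ii_of (by fun_prop) hδ one_pos
  have h1 := int_mono (f := fun t => (1/2) * (t ^ k * f t ^ 2) - 2 * (t ^ (k+2) * f' t ^ 2))
    (g := fun t => (k+1 : ℕ) * t ^ k * f t ^ 2 + t ^ (k+1) * (2 * f t * f' t))
    (by fun_prop) (by fun_prop) hδ hδ1 (fun t ht => by
      have ht0 : 0 < t := hδ.trans_le ht.1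
      have e : 0 ≤ t ^ k * (f t + 2 * (t * f' t)) ^ 2 := by positivity
      have e2 : 0 ≤ (k : ℝ) * t ^ k * f t ^ 2 := by positivity
      push_cast
      simp only [pow_succ] at *
      linarith)
  rw [ftc, intervalIntegral.integral_sub, intervalIntegral.integral_const_mul,
    intervalIntegral.integral_const_mul] at h1
  · have : 0 ≤ δ ^ (k+1) * f δ ^ 2 := by positivity
    rw [one_pow] at h1
    linarith
  · exact ii_of (by fun_prop) hδ one_pos
  · exact ii_of (by fun_prop) hδ one_pos

theorem cont_right {h : ℝ → ℝ} (ch : ContinuousOn h (Set.Ioi 0)) {x : ℝ} (hx : 0 < x) :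
    ContinuousOn (fun R => ∫ t in x..R, h t) (Set.Icc x 1) := by
  rcases le_or_gt x 1 with h1 | h1
  · have := intervalIntegral.continuousOn_primitive_interval (f := h) (μ := volume) (a := x) (b := 1)
      (by
        have := (ii_of ch hx one_pos)
        rw [Set.uIcc_of_le h1]
        exact (intervalIntegrable_iff_integrableOn_Icc_of_le h1).1 this)
    rwa [Set.uIcc_of_le h1] at this
  · rw [Set.Icc_eq_empty (by linarith)]; exact continuousOn_empty _

theorem covering {h F : ℝ → ℝ} (ch : ContinuousOn h (Set.Ioi 0)) (cF : ContinuousOn F (Set.Ioi 0))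
    (h0 : ∀ t, 0 < t → 0 ≤ h t) (F0 : ∀ t, 0 < t → 0 ≤ F t) (m N : ℕ) (hN : 1 ≤ N) {δ Q C : ℝ}
    (hδ : 0 < δ) (hδ1 : δ < 1) (hQ : 0 < Q) (hC : 0 ≤ C)
    (loc : ∀ x R, δ ≤ x → x < R → R ≤ 1 → (R - x) ^ N * (∫ t in x..R, h t) = Q * R ^ m →
      (∫ t in x..R, F t) ≤ C * ∫ t in x..R, h t)
    (big : Q ≤ (1 - δ) ^ N * ∫ t in δ..1, h t) :
    (∫ t in δ..1, F t) ≤ 2 * C * ∫ t in δ..1, h t := by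
  -- the last interval
  have hN0 : N ≠ 0 := by omega
  have sp : ∀ {f : ℝ → ℝ}, ContinuousOn f (Set.Ioi 0) → ∀ x y z : ℝ, 0 < x → 0 < y → 0 < z →
      (∫ t in x..y, f t) + (∫ t in y..z, f t) = ∫ t in x..z, f t := fun cf x y z hx hy hz =>
    intervalIntegral.integral_add_adjacent_intervals (ii_of cf hx hy) (ii_of cf hy hz)
  have hnn : ∀ x y : ℝ, 0 < x → x ≤ y → 0 ≤ ∫ t in x..y, h t := fun x y hx hxy =>
    intervalIntegral.integral_nonneg hxy fun t ht => h0 t (hx.trans_le ht.1)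
  have Fnn : ∀ x y : ℝ, 0 < x → x ≤ y → 0 ≤ ∫ t in x..y, F t := fun x y hx hxy =>
    intervalIntegral.integral_nonneg hxy fun t ht => F0 t (hx.trans_le ht.1)
  obtain ⟨z, hz, hzQ⟩ : ∃ z ∈ Set.Icc δ 1, (1 - z) ^ N * (∫ t in z..1, h t) = Q := by
    have c1 : ContinuousOn (fun z => (1 - z) ^ N * ∫ t in z..1, h t) (Set.Icc δ 1) := by
      have c2 : ContinuousOn (fun z => ∫ t in z..1, h t) (Set.Icc δ 1) := by
        have c3 : ContinuousOn (fun z => (∫ t in δ..1, h t) - ∫ t in δ..z, h t) (Set.Icc δ 1) :=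
          continuousOn_const.sub (cont_right ch hδ)
        refine c3.congr fun z hz => ?_
        have := sp ch δ z 1 hδ (hδ.trans_le hz.1) one_pos
        simp only
        linarith
      fun_prop
    have := intermediate_value_Icc' hδ1.le c1
    have h2 : Q ∈ Set.Icc ((1 - 1 : ℝ) ^ N * ∫ t in (1:ℝ)..1, h t) ((1 - δ) ^ N * ∫ t in δ..1, h t) :=
      ⟨by simp [hQ.le], big⟩
    obtain ⟨z, hz, e⟩ := this h2
    exact ⟨z, hz, e⟩
  have hz1 : z < 1 := by
    rcases hz.2.eq_or_lt with h | h
    · subst h; simp at hzQ; exact absurd hzQ hQ.ne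
    · exact h
  have hz0 : 0 < z := hδ.trans_le hz.1
  have last := loc z 1 hz.1 hz1 le_rfl (by rw [hzQ]; simp)
  set H := ∫ t in δ..1, h t with hH
  have hH0 : 0 ≤ H := hnn _ _ hδ hδ1.le
  obtain ⟨c, hc0, hc1, hc⟩ : ∃ c : ℝ, 0 < c ∧ c ≤ 1 ∧ c * H < Q * δ ^ m := by
    have hq : 0 < Q * δ ^ m := by positivity
    refine ⟨min 1 (Q * δ ^ m / (H + 1)), ?_, min_le_left _ _, ?_⟩
    · apply lt_min one_pos; positivity
    · calc min 1 (Q * δ ^ m / (H + 1)) * H ≤ (Q * δ ^ m / (H + 1)) * H := by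
            gcongr; exact min_le_right _ _
        _ < Q * δ ^ m := by
          rw [div_mul_eq_mul_div, div_lt_iff₀ (by positivity)]; nlinarith
  have step : ∀ x, δ ≤ x → x ≤ z → ∃ R, x + c ≤ R ∧ R ≤ 1 ∧
      (∫ t in x..R, F t) ≤ C * ∫ t in x..R, h t := by
    intro x hx hxz
    have hx0 : 0 < x := hδ.trans_le hx
    have hx1 : x < 1 := hxz.trans_lt hz1
    have c1 : ContinuousOn (fun R => (R - x) ^ N * (∫ t in x..R, h t) - Q * R ^ m) (Set.Icc x 1) := by
      have := cont_right ch hx0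
      fun_prop
    have h2 : (0:ℝ) ∈ Set.Icc ((x - x) ^ N * (∫ t in x..x, h t) - Q * x ^ m)
        ((1 - x) ^ N * (∫ t in x..1, h t) - Q * 1 ^ m) := by
      refine ⟨?_, ?_⟩
      · simp; positivity
      · have : Q ≤ (1 - x) ^ N * (∫ t in x..1, h t) := by
          rw [← hzQ]
          have := int_sub_mono ch h0 hx0 hxz hz1.le le_rfl
          have n := hnn z 1 hz0 hz1.le
          have : 0 ≤ 1 - z := by linarith
          gcongr
        simp; linarith
    obtain ⟨R, hR, e⟩ := intermediate_value_Icc hx1.le c1 h2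
    simp only at e
    have e' : (R - x) ^ N * (∫ t in x..R, h t) = Q * R ^ m := by linarith
    have hxR : x < R := by
      rcases hR.1.eq_or_lt with h | h
      · subst h; simp at e'
        have : 0 < Q * x ^ m := by positivity
        rcases e' with e' | e'
        · linarith
        · exact absurd e'.1 hx0.ne'
      · exact h
    refine ⟨R, ?_, hR.2, loc x R hx hxR hR.2 e'⟩
    by_contra hlt
    push Not at hlt
    have k1 : (R - x) ^ N ≤ c := by
      calc (R - x) ^ N ≤ c ^ N := by
            have : 0 ≤ R - x := by linarith
            gcongr; linarith
        _ ≤ c := pow_le_of_le_one hc0.le hc1 hN0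
    have k2 : (∫ t in x..R, h t) ≤ H := int_sub_mono ch h0 hδ hx hxR.le hR.2
    have k3 : (R - x) ^ N * (∫ t in x..R, h t) ≤ c * H :=
      mul_le_mul k1 k2 (hnn _ _ hx0 hxR.le) hc0.le
    have k4 : Q * δ ^ m ≤ Q * R ^ m := by
      have : δ ≤ R := hx.trans hxR.le
      gcongr
    linarith
  have ind : ∀ n : ℕ, ∀ x, δ ≤ x → x ≤ z → z - x ≤ n * c →
      (∫ t in x..z, F t) ≤ C * ∫ t in x..1, h t := by
    intro n
    induction n with
    | zero =>
      intro x hx hxz hn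
      have : x = z := by simp at hn; linarith
      subst this
      simp only [intervalIntegral.integral_same]
      exact mul_nonneg hC (hnn _ _ hz0 hz1.le)
    | succ n ih =>
      intro x hx hxz hn
      have hx0 : 0 < x := hδ.trans_le hx
      obtain ⟨R, hR1, hR2, hR⟩ := step x hx hxz
      have hR0 : 0 < R := by linarith
      have s := sp ch x R 1 hx0 hR0 one_pos
      rcases le_total z R with hzR | hRz
      · have a1 := int_sub_mono cF F0 hx0 le_rfl hxz hzR
        have := hnn R 1 hR0 hR2
        rw [← s, mul_add]
        have := mul_nonneg hC this
        linarith
      · have a1 := ih R (by linarith) hRz (by push_cast at hn; linarith)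
        rw [← s, ← sp cF x R z hx0 hR0 hz0, mul_add]
        linarith
  obtain ⟨n, hn⟩ := exists_nat_ge ((z - δ) / c)
  rw [div_le_iff₀ hc0] at hn
  have fin := ind n δ le_rfl hz.1 hn
  have l2 := int_sub_mono ch h0 hδ hz.1 hz1.le (le_refl (1:ℝ))
  rw [← sp cF δ z 1 hδ hz0 one_pos]
  have := mul_le_mul_of_nonneg_left l2 hC
  linarith

/-- the truncated energy of order m -/
def En (m : ℕ) (p : ℕ → ℝ → ℝ) (x R : ℝ) : ℝ := ∫ t in x..R, (t ^ m * p m t ^ 2 + p 0 t ^ 2)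

theorem Tower.contE {p : ℕ → ℝ → ℝ} (hp : Tower p) (m : ℕ) :
    ContinuousOn (fun t => t ^ m * p m t ^ 2 + p 0 t ^ 2) (Set.Ioi 0) := by
  have := hp.contOn m
  have := hp.contOn 0
  fun_prop

theorem En_nonneg (m : ℕ) (p : ℕ → ℝ → ℝ) {x R : ℝ} (hx : 0 < x) (hxR : x ≤ R) : 0 ≤ En m p x R :=
  intervalIntegral.integral_nonneg hxR fun t ht => by
    have : 0 < t := hx.trans_le ht.1
    positivity

theorem En_ge0 {m : ℕ} {p : ℕ → ℝ → ℝ} (hp : Tower p) {x R : ℝ} (hx : 0 < x) (hxR : x ≤ R) :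
    (∫ t in x..R, p 0 t ^ 2) ≤ En m p x R :=
  int_mono (f := fun t => p 0 t ^ 2) (by have := hp.contOn 0; fun_prop) (hp.contE m) hx hxR fun t ht => by
    have : 0 < t := hx.trans_le ht.1
    have : 0 ≤ t ^ m * p m t ^ 2 := by positivity
    linarith

theorem En_gem {m : ℕ} {p : ℕ → ℝ → ℝ} (hp : Tower p) {x R : ℝ} (hx : 0 < x) (hxR : x ≤ R) :
    (∫ t in x..R, t ^ m * p m t ^ 2) ≤ En m p x R :=
  int_mono (by have := hp.contOn m; fun_prop) (hp.contE m) hx hxR fun t ht => by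
    have : 0 ≤ p 0 t ^ 2 := by positivity
    linarith

theorem satA {m : ℕ} (hm : 1 ≤ m) {p : ℕ → ℝ → ℝ} (hp : Tower p) {δ : ℝ} (hδ : 0 < δ)
    (hδ1 : δ ≤ 1 / 2) :
    (∫ t in δ..1, p 0 t ^ 2) ≤ √(2 * En m p δ 1) ^ 2 * (1 - δ) ∧
    (1 - δ) ^ (2 * m) * (∫ t in δ..1, t ^ m * p m t ^ 2) ≤
      √(2 * En m p δ 1) ^ 2 * 1 ^ m * (1 - δ) := by
  have h1 : δ ≤ 1 := by linarith
  have n := En_nonneg m p hδ h1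
  have g0 := En_ge0 (m := m) hp hδ h1
  have gm := En_gem (m := m) hp hδ h1
  rw [Real.sq_sqrt (by positivity), one_pow, mul_one]
  constructor
  · nlinarith
  · have k : (1 - δ) ^ (2 * m) ≤ 1 - δ := pow_le_of_le_one (by linarith) (by linarith) (by omega)
    have k0 : 0 ≤ 1 - δ := by linarith
    calc _ ≤ (1 - δ) ^ (2 * m) * (2 * En m p δ 1) := by gcongr; linarith
      _ ≤ (1 - δ) * (2 * En m p δ 1) := by gcongr
      _ = _ := by ring

theorem hsum {m : ℕ} {p q : ℕ → ℝ → ℝ} (hp : Tower p) (hq : Tower q) (U V : ℝ) {x R : ℝ}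
    (hx : 0 < x) (hxR : x ≤ R) :
    (∫ t in x..R, (V ^ 2 * (t ^ m * p m t ^ 2 + p 0 t ^ 2) +
      U ^ 2 * (t ^ m * q m t ^ 2 + q 0 t ^ 2))) = V ^ 2 * En m p x R + U ^ 2 * En m q x R := by
  have c1 := hp.contE m
  have c2 := hq.contE m
  have hR := hx.trans_le hxR
  rw [intervalIntegral.integral_add, intervalIntegral.integral_const_mul,
    intervalIntegral.integral_const_mul]
  · rfl
  · exact ii_of (continuousOn_const.mul c1) hx hR
  · exact ii_of (continuousOn_const.mul c2) hx hR

theorem cross (m : ℕ) : ∃ C : ℝ, 0 ≤ C ∧ ∀ a b, 1 ≤ a → 1 ≤ b → a + b = m → ∀ p q, Tower p →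
    Tower q → ∀ U V : ℝ, 0 < U → 0 < V → (∀ t ∈ Set.Ioc (0:ℝ) 1, |p 0 t| ≤ U) →
    (∀ t ∈ Set.Ioc (0:ℝ) 1, |q 0 t| ≤ V) → ∀ δ, 0 < δ → δ ≤ 1 / 2 →
    (∫ t in δ..1, t ^ m * p a t ^ 2 * q b t ^ 2) ≤ C * (V ^ 2 * En m p δ 1 + U ^ 2 * En m q δ 1) := by
  obtain ⟨K, hK, hsup⟩ := supL m
  refine ⟨2 * K ^ 4 + 4 ^ (2 * m + 1) * K ^ 4, by positivity, ?_⟩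
  intro a b ha hb hab p q hp hq U V hU hV hpU hqV δ hδ hδ2
  have hδ1 : δ < 1 := by linarith
  have cF : ContinuousOn (fun t => t ^ m * p a t ^ 2 * q b t ^ 2) (Set.Ioi 0) := by
    have := hp.contOn a
    have := hq.contOn b
    fun_prop
  have F0 : ∀ t : ℝ, 0 < t → 0 ≤ t ^ m * p a t ^ 2 * q b t ^ 2 := fun t ht => by positivity
  -- local bound
  have loc0 : ∀ x R A B : ℝ, 0 < x → x < R → 0 ≤ A → 0 ≤ B →
      (∫ t in x..R, p 0 t ^ 2) ≤ A ^ 2 * (R - x) →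
      (R - x) ^ (2 * m) * (∫ t in x..R, t ^ m * p m t ^ 2) ≤ A ^ 2 * R ^ m * (R - x) →
      (∫ t in x..R, q 0 t ^ 2) ≤ B ^ 2 * (R - x) →
      (R - x) ^ (2 * m) * (∫ t in x..R, t ^ m * q m t ^ 2) ≤ B ^ 2 * R ^ m * (R - x) →
      (R - x) ^ (2 * m) * (∫ t in x..R, t ^ m * p a t ^ 2 * q b t ^ 2) ≤
        K ^ 4 * (A ^ 2 * B ^ 2) * R ^ m * (R - x) := by
    intro x R A B hx hxR hA hB h1 h2 h3 h4
    have s1 := hsup a (by omega) ha p hp x R A hx hxR hA h1 h2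
    have s2 := hsup b (by omega) hb q hq x R B hx hxR hB h3 h4
    rw [← intervalIntegral.integral_const_mul]
    have hR : 0 < R := hx.trans hxR
    have hl : 0 ≤ R - x := by linarith
    have := int_mono (f := fun y => (R - x) ^ (2*m) * (y ^ m * p a y ^ 2 * q b y ^ 2))
      (g := fun _ => K ^ 4 * (A ^ 2 * B ^ 2) * R ^ m)
      (continuousOn_const.mul cF) continuousOn_const hx hxR.le
      (fun y hy => by
        have hy0 : 0 < y := hx.trans_le hy.1
        have k1 := pow_le_pow_left₀ (by positivity) (mul_le_mul (s1 y hy) (s2 y hy) (by positivity)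
          (by positivity)) 2
        have e1 : (√y ^ a * |p a y| * (R - x) ^ a * (√y ^ b * |q b y| * (R - x) ^ b)) ^ 2 =
            (R - x) ^ (2 * m) * (y ^ m * p a y ^ 2 * q b y ^ 2) := by
          rw [← hab]
          have : (√y ^ a * |p a y| * (R - x) ^ a * (√y ^ b * |q b y| * (R - x) ^ b)) ^ 2 =
            (R - x) ^ (2 * (a+b)) * ((√y ^ 2) ^ (a+b) * |p a y| ^ 2 * |q b y| ^ 2) := by
            generalize R - x = l
            ring
          rw [this, Real.sq_sqrt hy0.le, sq_abs, sq_abs]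
        have e2 : (K * A * √R ^ a * (K * B * √R ^ b)) ^ 2 = K ^ 4 * (A ^ 2 * B ^ 2) * R ^ m := by
          rw [← hab]
          have : (K * A * √R ^ a * (K * B * √R ^ b)) ^ 2 =
            K ^ 4 * (A ^ 2 * B ^ 2) * (√R ^ 2) ^ (a+b) := by ring
          rw [this, Real.sq_sqrt hR.le]
        rw [e1, e2] at k1
        exact k1)
    rw [intervalIntegral.integral_const, smul_eq_mul] at this
    linarith
  have n1 := En_nonneg m p hδ hδ1.le
  have n2 := En_nonneg m q hδ hδ1.le
  obtain ⟨N, hN⟩ : ∃ N, N + 1 = 2 * m := ⟨2 * m - 1, by omega⟩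
  have hK4 : 0 ≤ K ^ 4 := by positivity
  rcases le_total (U ^ 2 * V ^ 2) ((1 - δ) ^ N * (V ^ 2 * En m p δ 1 + U ^ 2 * En m q δ 1)) with
    big | small
  · have := covering (h := fun t => V ^ 2 * (t ^ m * p m t ^ 2 + p 0 t ^ 2) +
      U ^ 2 * (t ^ m * q m t ^ 2 + q 0 t ^ 2)) (Q := U ^ 2 * V ^ 2) (C := K ^ 4)
      (by have c1 := hp.contE m
          have c2 := hq.contE m
          exact (continuousOn_const.mul c1).add (continuousOn_const.mul c2))
      cF (fun t ht => by positivity) F0 m N (by omega) hδ hδ1 (by positivity) hK4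
      (by
        intro x R hx hxR hR1 e
        have hx0 : 0 < x := hδ.trans_le hx
        have hR : 0 < R := hx0.trans hxR
        rw [hsum hp hq U V hx0 hxR.le] at e ⊢
        have hl : 0 < R - x := by linarith
        have sq0 : ∀ (r : ℕ → ℝ → ℝ) (W : ℝ), Tower r → (∀ t ∈ Set.Ioc (0:ℝ) 1, |r 0 t| ≤ W) →
            (∫ t in x..R, r 0 t ^ 2) ≤ W ^ 2 * (R - x) := by
          intro r W hr hW
          have := int_mono (g := fun _ => W ^ 2) ((hr.contOn 0).pow 2) continuousOn_const hx0 hxR.le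
            (fun t ht => by
              have := hW t ⟨hx0.trans_le ht.1, ht.2.trans hR1⟩
              simp only [Pi.pow_apply]
              rw [← sq_abs]
              gcongr)
          rw [intervalIntegral.integral_const, smul_eq_mul] at this
          simp only [Pi.pow_apply] at this
          linarith
        have np := En_nonneg m p hx0 hxR.le
        have nq := En_nonneg m q hx0 hxR.le
        have gp := En_gem (m := m) hp hx0 hxR.le
        have gq := En_gem (m := m) hq hx0 hxR.le
        have z0 := loc0 x R U V hx0 hxR hU.le hV.le (sq0 p U hp hpU)
          (by
            refine le_of_mul_le_mul_left ?_ (show 0 < V ^ 2 by positivity)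
            calc _ = (R - x) * ((R - x) ^ N * (V ^ 2 * ∫ t in x..R, t ^ m * p m t ^ 2)) := by
                  rw [← hN, pow_succ]; ring
              _ ≤ (R - x) * ((R - x) ^ N * (V ^ 2 * En m p x R + U ^ 2 * En m q x R)) := by
                  gcongr
                  nlinarith [mul_le_mul_of_nonneg_left gp (sq_nonneg V), mul_nonneg (sq_nonneg U) nq]
              _ = _ := by rw [e]; ring)
          (sq0 q V hq hqV)
          (by
            refine le_of_mul_le_mul_left ?_ (show 0 < U ^ 2 by positivity)
            calc _ = (R - x) * ((R - x) ^ N * (U ^ 2 * ∫ t in x..R, t ^ m * q m t ^ 2)) := by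
                  rw [← hN, pow_succ]; ring
              _ ≤ (R - x) * ((R - x) ^ N * (V ^ 2 * En m p x R + U ^ 2 * En m q x R)) := by
                  gcongr
                  nlinarith [mul_le_mul_of_nonneg_left gq (sq_nonneg U), mul_nonneg (sq_nonneg V) np]
              _ = _ := by rw [e]; ring)
        refine le_of_mul_le_mul_left (z0.trans_eq ?_) (pow_pos hl (2 * m))
        rw [mul_assoc (K ^ 4), ← e, ← hN, pow_succ]
        ring)
      (by rw [hsum hp hq U V hδ hδ1.le]; exact big)
    rw [hsum hp hq U V hδ hδ1.le] at this
    refine this.trans ?_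
    gcongr
    have : 0 ≤ 4 ^ (2 * m + 1) * K ^ 4 := by positivity
    linarith
  · have hm : 1 ≤ m := by omega
    obtain ⟨p1, p2⟩ := satA hm hp hδ hδ2
    obtain ⟨q1, q2⟩ := satA hm hq hδ hδ2
    have z0 := loc0 δ 1 _ _ hδ hδ1 (Real.sqrt_nonneg _) (Real.sqrt_nonneg _) p1 p2 q1 q2
    rw [Real.sq_sqrt (by positivity), Real.sq_sqrt (by positivity), one_pow, mul_one] at z0
    set P := En m p δ 1
    set Q := En m q δ 1
    set S := V ^ 2 * P + U ^ 2 * Q with hS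
    have hS0 : 0 ≤ S := by positivity
    set I := ∫ t in δ..1, t ^ m * p a t ^ 2 * q b t ^ 2
    obtain ⟨l, hl⟩ : ∃ l, l = 1 - δ := ⟨_, rfl⟩
    rw [← hl] at z0 small
    have hl1 : 1 ≤ 2 * l := by rw [hl]; linarith
    have hl0 : 0 < l := by linarith
    have hQ0 : 0 < U ^ 2 * V ^ 2 := by positivity
    have w1 : l ^ N * I ≤ 4 * K ^ 4 * (P * Q) := by
      refine le_of_mul_le_mul_left ?_ hl0
      calc _ = l ^ (2 * m) * I := by rw [← hN, pow_succ]; ring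
        _ ≤ _ := z0
        _ = _ := by ring
    have w2 : (U ^ 2 * V ^ 2) * (P * Q) ≤ S * S := by
      have : 0 ≤ V ^ 2 * P := by positivity
      have : 0 ≤ U ^ 2 * Q := by positivity
      rw [hS]
      nlinarith [mul_nonneg ‹0 ≤ V ^ 2 * P› ‹0 ≤ U ^ 2 * Q›]
    have w3 : l ^ N * l ^ N * I ≤ 4 * K ^ 4 * S := by
      refine le_of_mul_le_mul_left ?_ hQ0
      calc _ = (U ^ 2 * V ^ 2) * l ^ N * (l ^ N * I) := by ring
        _ ≤ (U ^ 2 * V ^ 2) * l ^ N * (4 * K ^ 4 * (P * Q)) := by gcongr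
        _ = 4 * K ^ 4 * l ^ N * ((U ^ 2 * V ^ 2) * (P * Q)) := by ring
        _ ≤ 4 * K ^ 4 * l ^ N * (S * S) := by gcongr
        _ = 4 * K ^ 4 * S * (l ^ N * S) := by ring
        _ ≤ 4 * K ^ 4 * S * (U ^ 2 * V ^ 2) := by gcongr
        _ = _ := by ring
    have hI : 0 ≤ I := intervalIntegral.integral_nonneg hδ1.le fun t ht => F0 t (hδ.trans_le ht.1)
    calc I ≤ (2 * l) ^ (2 * N) * I := le_mul_of_one_le_left hI (one_le_pow₀ hl1)
      _ = 4 ^ N * (l ^ N * l ^ N * I) := by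
        rw [pow_mul, mul_pow, mul_pow]; ring
      _ ≤ 4 ^ N * (4 * K ^ 4 * S) := by gcongr
      _ ≤ 4 ^ (2 * m) * (4 * K ^ 4 * S) := by
        gcongr
        · norm_num
        · omega
      _ = 4 ^ (2 * m + 1) * K ^ 4 * S := by ring
      _ ≤ _ := by gcongr; linarith

theorem lemH_aux (m : ℕ) (k : ℕ) : ∃ C : ℝ, 0 ≤ C ∧ ∀ n, n + k = m → ∀ p, Tower p → ∀ δ : ℝ,
    0 < δ → δ ≤ 1 / 2 → (∫ t in δ..1, t ^ (2 * n - m) * p n t ^ 2) ≤ C * En m p δ 1 := by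
  induction k with
  | zero =>
    refine ⟨1, zero_le_one, fun n hn p hp δ hδ hδ2 => ?_⟩
    have : n = m := by omega
    subst this
    rw [show 2 * n - n = n by omega, one_mul]
    exact En_gem hp hδ (by linarith)
  | succ k ih =>
    obtain ⟨C, hC, ih⟩ := ih
    obtain ⟨D, hD, hend⟩ := endpt m
    refine ⟨2 * (4 ^ m * D ^ 2 * 2) + 4 * C, by positivity, fun n hn p hp δ hδ hδ2 => ?_⟩
    have hδ1 : δ < 1 := by linarith
    have ih := ih (n+1) (by omega) p hp δ hδ hδ2
    have hm : 1 ≤ m := by omega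
    obtain ⟨p1, p2⟩ := satA hm hp hδ hδ2
    have he := hend n (by omega) p hp δ 1 _ hδ hδ1 (Real.sqrt_nonneg _) p1 p2
    have nE := En_nonneg m p hδ hδ1.le
    have cn := hp.contOn (n+1)
    have hh := hardy (hp n) cn (2 * n - m) hδ hδ1.le
    have h3 := int_mono (f := fun t => t ^ (2 * n - m + 2) * p (n+1) t ^ 2)
      (g := fun t => t ^ (2 * (n+1) - m) * p (n+1) t ^ 2) (by fun_prop) (by fun_prop) hδ hδ1.le
      (fun t ht => by
        have : t ^ (2 * n - m + 2) ≤ t ^ (2 * (n+1) - m) :=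
          pow_le_pow_of_le_one (hδ.le.trans ht.1) ht.2 (by omega)
        gcongr)
    have h4 : p n 1 ^ 2 ≤ 4 ^ m * D ^ 2 * 2 * En m p δ 1 := by
      have k1 := pow_le_pow_left₀ (by have : 0 ≤ 1 - δ := by linarith
                                      positivity) he 2
      rw [mul_pow D, Real.sq_sqrt (by positivity), mul_pow, sq_abs] at k1
      have hl1 : 1 ≤ 2 * (1 - δ) := by linarith
      calc p n 1 ^ 2 ≤ (2 * (1 - δ)) ^ (2 * n) * p n 1 ^ 2 :=
            le_mul_of_one_le_left (sq_nonneg _) (one_le_pow₀ hl1)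
        _ = 4 ^ n * (((1 - δ) ^ n) ^ 2 * p n 1 ^ 2) := by
            
            generalize 1 - δ = l
            rw [mul_pow, pow_mul, show (2:ℝ)^2 = 4 by norm_num]; ring
        _ ≤ 4 ^ n * (D ^ 2 * (2 * En m p δ 1)) := by gcongr
        _ ≤ 4 ^ m * (D ^ 2 * (2 * En m p δ 1)) := by
          gcongr
          · norm_num
          · omega
        _ = _ := by ring
    nlinarith

theorem lemH (m : ℕ) : ∃ C : ℝ, 0 ≤ C ∧ ∀ n < m + 1, ∀ p, Tower p → ∀ δ : ℝ,
    0 < δ → δ ≤ 1 / 2 → (∫ t in δ..1, t ^ (2 * n - m) * p n t ^ 2) ≤ C * En m p δ 1 := by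
  apply unif
  · intro a C D hCD h p hp δ hδ hδ2
    refine (h p hp δ hδ hδ2).trans ?_
    have := En_nonneg m p hδ (by linarith : δ ≤ 1)
    gcongr
  · intro a ha
    obtain ⟨C, hC, h⟩ := lemH_aux m (m - a)
    exact ⟨C, hC, h a (by omega)⟩

theorem assem_pos (m : ℕ) : ∃ C : ℝ, 0 ≤ C ∧ ∀ p q r, Tower p → Tower q → Tower r →
    (∀ t, 0 < t → r m t = ∑ i ∈ Finset.range (m + 1), (m.choose i : ℝ) * p i t * q (m - i) t) →
    (∀ t, 0 < t → r 0 t = p 0 t * q 0 t) → ∀ U V : ℝ, 0 < U → 0 < V →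
    (∀ t ∈ Set.Ioc (0:ℝ) 1, |p 0 t| ≤ U) → (∀ t ∈ Set.Ioc (0:ℝ) 1, |q 0 t| ≤ V) →
    ∀ δ, 0 < δ → δ ≤ 1 / 2 →
    En m r δ 1 ≤ C * (V ^ 2 * En m p δ 1 + U ^ 2 * En m q δ 1) := by
  obtain ⟨C, hC, hcr⟩ := cross m
  obtain ⟨K, hK⟩ : ∃ K : ℝ, K = (m + 1) * (2 ^ m) ^ 2 := ⟨_, rfl⟩
  have hK0 : 0 ≤ K := by rw [hK]; positivity
  refine ⟨(m + 1) * (K * (C + 1)) + 1, by positivity, ?_⟩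
  intro p q r hp hq hr hrm hr0 U V hU hV hpU hqV δ hδ hδ2
  have hδ1 : δ ≤ 1 := by linarith
  have n1 := En_nonneg m p hδ hδ1
  have n2 := En_nonneg m q hδ hδ1
  obtain ⟨S, hS⟩ : ∃ S, S = V ^ 2 * En m p δ 1 + U ^ 2 * En m q δ 1 := ⟨_, rfl⟩
  have hpS : V ^ 2 * En m p δ 1 ≤ S := by rw [hS]; nlinarith [mul_nonneg (sq_nonneg U) n2]
  have hqS : U ^ 2 * En m q δ 1 ≤ S := by rw [hS]; nlinarith [mul_nonneg (sq_nonneg V) n1]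
  have hS0 : 0 ≤ S := by rw [hS]; positivity
  have cF : ∀ i, ContinuousOn (fun t => t ^ m * p i t ^ 2 * q (m - i) t ^ 2) (Set.Ioi 0) := by
    intro i
    have := hp.contOn i
    have := hq.contOn (m - i)
    fun_prop
  have hsq : ∀ t ∈ Set.Icc δ 1, p 0 t ^ 2 ≤ U ^ 2 ∧ q 0 t ^ 2 ≤ V ^ 2 := by
    intro t ht
    have h0 : t ∈ Set.Ioc (0:ℝ) 1 := ⟨hδ.trans_le ht.1, ht.2⟩
    rw [← sq_abs (p 0 t), ← sq_abs (q 0 t)]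
    exact ⟨pow_le_pow_left₀ (abs_nonneg _) (hpU t h0) 2, pow_le_pow_left₀ (abs_nonneg _) (hqV t h0) 2⟩
  have term : ∀ i ∈ Finset.range (m + 1),
      (∫ t in δ..1, t ^ m * p i t ^ 2 * q (m - i) t ^ 2) ≤ (C + 1) * S := by
    intro i hi
    rw [Finset.mem_range] at hi
    rcases Nat.eq_zero_or_pos i with h0 | h0
    · subst h0
      have := int_mono (g := fun t => U ^ 2 * (t ^ m * q m t ^ 2)) (cF 0)
        (by have := hq.contOn m; fun_prop) hδ hδ1 (fun t ht => by
          have ht0 : 0 < t := hδ.trans_le ht.1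
          have := (hsq t ht).1
          rw [Nat.sub_zero]
          have : 0 ≤ t ^ m * q m t ^ 2 := by positivity
          nlinarith)
      rw [intervalIntegral.integral_const_mul] at this
      have := mul_le_mul_of_nonneg_left (En_gem (m := m) hq hδ hδ1) (sq_nonneg U)
      nlinarith
    rcases Nat.eq_or_lt_of_le (Nat.lt_succ_iff.mp hi) with h1 | h1
    · subst h1
      have := int_mono (g := fun t => V ^ 2 * (t ^ i * p i t ^ 2)) (cF i)
        (by have := hp.contOn i; fun_prop) hδ hδ1 (fun t ht => by
          have ht0 : 0 < t := hδ.trans_le ht.1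
          have := (hsq t ht).2
          rw [Nat.sub_self]
          have : 0 ≤ t ^ i * p i t ^ 2 := by positivity
          nlinarith)
      rw [intervalIntegral.integral_const_mul] at this
      have := mul_le_mul_of_nonneg_left (En_gem (m := i) hp hδ hδ1) (sq_nonneg V)
      nlinarith
    · have := hcr i (m - i) h0 (by omega) (by omega) p q hp hq U V hU hV hpU hqV δ hδ hδ2
      rw [← hS] at this
      nlinarith
  have c0 : ContinuousOn (fun t => V ^ 2 * p 0 t ^ 2) (Set.Ioi 0) := by
    have := hp.contOn 0
    fun_prop
  have cS : ContinuousOn (fun t => ∑ i ∈ Finset.range (m + 1),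
      K * (t ^ m * p i t ^ 2 * q (m - i) t ^ 2)) (Set.Ioi 0) :=
    continuousOn_finsetSum _ fun i _ => continuousOn_const.mul (cF i)
  have main := int_mono (g := fun t => (∑ i ∈ Finset.range (m + 1),
      K * (t ^ m * p i t ^ 2 * q (m - i) t ^ 2)) + V ^ 2 * p 0 t ^ 2) (hr.contE m)
      (cS.add c0) hδ hδ1 (fun t ht => by
        have ht0 : 0 < t := hδ.trans_le ht.1
        refine add_le_add ?_ ?_
        · rw [hrm t ht0]
          have := sq_sum_le_card_mul_sum_sq (s := Finset.range (m + 1))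
            (f := fun i => (m.choose i : ℝ) * p i t * q (m - i) t)
          rw [Finset.card_range] at this
          refine (mul_le_mul_of_nonneg_left this (pow_nonneg ht0.le m)).trans ?_
          rw [← mul_assoc, Finset.mul_sum]
          refine Finset.sum_le_sum fun i hi => ?_
          have hc : (m.choose i : ℝ) ≤ 2 ^ m := by
            exact_mod_cast Nat.choose_le_two_pow m i
          have hc2 : (m.choose i : ℝ) ^ 2 ≤ (2 ^ m) ^ 2 := by gcongr
          have := mul_le_mul_of_nonneg_left hc2
            (show 0 ≤ ((m:ℝ) + 1) * (t ^ m * p i t ^ 2 * q (m - i) t ^ 2) by positivity)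
          rw [hK]
          push_cast
          nlinarith
        · rw [hr0 t ht0]
          have := (hsq t ht).2
          nlinarith [sq_nonneg (p 0 t)])
  rw [intervalIntegral.integral_add (ii_of cS hδ one_pos) (ii_of c0 hδ one_pos),
    intervalIntegral.integral_finsetSum
      (f := fun i t => K * (t ^ m * p i t ^ 2 * q (m - i) t ^ 2))
      (fun i _ => ii_of (continuousOn_const.mul (cF i)) hδ one_pos),
    intervalIntegral.integral_const_mul] at main
  have hsum : (∑ i ∈ Finset.range (m + 1),
      ∫ t in δ..1, K * (t ^ m * p i t ^ 2 * q (m - i) t ^ 2)) ≤ (m + 1) * (K * (C + 1) * S) := by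
    refine (Finset.sum_le_card_nsmul _ _ (K * (C + 1) * S) fun i hi => ?_).trans_eq ?_
    · rw [intervalIntegral.integral_const_mul, mul_assoc]
      exact mul_le_mul_of_nonneg_left (term i hi) hK0
    · simp
  have h0 := mul_le_mul_of_nonneg_left (En_ge0 (m := m) hp hδ hδ1) (sq_nonneg V)
  rw [← hS]
  refine main.trans ?_
  linarith

theorem assem (m : ℕ) : ∃ C : ℝ, 0 ≤ C ∧ ∀ p q r, Tower p → Tower q → Tower r →
    (∀ t, 0 < t → r m t = ∑ i ∈ Finset.range (m + 1), (m.choose i : ℝ) * p i t * q (m - i) t) →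
    (∀ t, 0 < t → r 0 t = p 0 t * q 0 t) → ∀ U V : ℝ, 0 ≤ U → 0 ≤ V →
    (∀ t ∈ Set.Ioc (0:ℝ) 1, |p 0 t| ≤ U) → (∀ t ∈ Set.Ioc (0:ℝ) 1, |q 0 t| ≤ V) →
    ∀ δ, 0 < δ → δ ≤ 1 / 2 → ∀ n < m + 1,
    (∫ t in δ..1, t ^ (2 * n - m) * r n t ^ 2) ≤
      C * (V ^ 2 * En m p δ 1 + U ^ 2 * En m q δ 1) := by
  obtain ⟨C, hC, h⟩ := assem_pos m
  obtain ⟨D, hD, hH⟩ := lemH m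
  refine ⟨D * C, by positivity, ?_⟩
  intro p q r hp hq hr hrm hr0 U V hU hV hpU hqV δ hδ hδ2 n hn
  refine (hH n hn r hr δ hδ hδ2).trans ?_
  rw [mul_assoc]
  refine mul_le_mul_of_nonneg_left ?_ hD
  have lim : Filter.Tendsto (fun ε : ℝ => C * ((V + ε) ^ 2 * En m p δ 1 + (U + ε) ^ 2 * En m q δ 1))
      (nhdsWithin 0 (Set.Ioi 0)) (nhds (C * (V ^ 2 * En m p δ 1 + U ^ 2 * En m q δ 1))) := by
    have : Continuous (fun ε : ℝ => C * ((V + ε) ^ 2 * En m p δ 1 + (U + ε) ^ 2 * En m q δ 1)) := by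
      fun_prop
    have := this.tendsto 0
    simp only [add_zero] at this
    exact this.mono_left nhdsWithin_le_nhds
  refine ge_of_tendsto lim ?_
  filter_upwards [self_mem_nhdsWithin] with ε hε
  have hε : 0 < ε := hε
  exact h p q r hp hq hr hrm hr0 (U + ε) (V + ε) (by linarith) (by linarith)
    (fun t ht => (hpU t ht).trans (by linarith)) (fun t ht => (hqV t ht).trans (by linarith)) δ hδ hδ2

theorem transfer {f g : ℝ → ℝ} (hf : ContinuousOn f (Set.Ioi 0)) (hg : ContinuousOn g (Set.Ioi 0))
    (f0 : ∀ t, 0 < t → 0 ≤ f t) (g0 : ∀ t, 0 < t → 0 ≤ g t)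
    (h : ∀ δ : ℝ, 0 < δ → δ ≤ 1 / 2 → (∫ t in δ..1, f t) ≤ ∫ t in δ..1, g t) :
    (∫⁻ s in Set.Ioo (0:ℝ) 1, ENNReal.ofReal (f s)) ≤
      ∫⁻ s in Set.Ioo (0:ℝ) 1, ENNReal.ofReal (g s) := by
  have key : ∀ k : ℝ → ℝ, ContinuousOn k (Set.Ioi 0) → (∀ t, 0 < t → 0 ≤ k t) → ∀ δ : ℝ, 0 < δ →
      δ ≤ 1 / 2 → (∫⁻ s in Set.Ioo δ 1, ENNReal.ofReal (k s)) =
        ENNReal.ofReal (∫ t in δ..1, k t) := by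
    intro k hk k0 δ hδ hδ2
    have hi := ii_of hk hδ one_pos
    rw [intervalIntegral.integral_of_le (by linarith), integral_Ioc_eq_integral_Ioo]
    rw [ofReal_integral_eq_lintegral_ofReal]
    · exact (hi.1).mono_set Set.Ioo_subset_Ioc_self
    · filter_upwards [ae_restrict_mem measurableSet_Ioo] with t ht
      exact k0 t (hδ.trans ht.1)
  have hU : Set.Ioo (0:ℝ) 1 = ⋃ n : ℕ, Set.Ioo (1 / ((n:ℝ) + 2)) 1 := by
    ext t
    simp only [Set.mem_Ioo, Set.mem_iUnion]
    constructor
    · rintro ⟨h0, h1⟩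
      obtain ⟨n, hn⟩ := exists_nat_one_div_lt h0
      refine ⟨n, lt_of_le_of_lt ?_ hn, h1⟩
      gcongr
      norm_num
    · rintro ⟨n, h0, h1⟩
      exact ⟨lt_trans (by positivity) h0, h1⟩
  rw [hU, setLIntegral_iUnion_of_directed]
  · refine iSup_le fun n => ?_
    have hn : (0:ℝ) < 1 / ((n:ℝ) + 2) := by positivity
    have hn2 : 1 / ((n:ℝ) + 2) ≤ 1 / 2 := by
      gcongr
      have : (0:ℝ) ≤ n := by positivity
      linarith
    rw [key f hf f0 _ hn hn2]
    refine (ENNReal.ofReal_le_ofReal (h _ hn hn2)).trans ?_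
    rw [← key g hg g0 _ hn hn2]
    exact lintegral_mono_set (Set.subset_iUnion (fun n : ℕ => Set.Ioo (1 / ((n:ℝ) + 2)) 1) n)
  · refine directed_of_isDirected_le fun a b hab => Set.Ioo_subset_Ioo_left ?_
    gcongr

theorem towerOf {u : ℝ → ℝ} (hu : ContDiffOn ℝ (⊤ : ℕ∞) u (Set.Ioi 0)) :
    Tower (fun n => iteratedDeriv n u) := by
  intro i t ht
  have h1 := hu.differentiableOn_iteratedDerivWithin (m := i) (by exact_mod_cast WithTop.coe_lt_top i)
    isOpen_Ioi.uniqueDiffOn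
  have h2 := (h1.congr (f₁ := iteratedDeriv i u)
    fun x hx => (iteratedDerivWithin_of_isOpen isOpen_Ioi hx).symm).differentiableAt (Ioi_mem_nhds ht)
  show HasDerivAt (iteratedDeriv i u) (iteratedDeriv (i+1) u t) t
  rw [iteratedDeriv_succ]
  exact h2.hasDerivAt

/-- the lower integral of a real function over (0,1) -/
def Lw (f : ℝ → ℝ) : ℝ≥0∞ := ∫⁻ s in Set.Ioo (0:ℝ) 1, ENNReal.ofReal (f s)

theorem Lw_add {f g : ℝ → ℝ} (hf : ContinuousOn f (Set.Ioi 0))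
    (f0 : ∀ t, 0 < t → 0 ≤ f t) (g0 : ∀ t, 0 < t → 0 ≤ g t) :
    Lw (fun t => f t + g t) = Lw f + Lw g := by
  unfold Lw
  rw [← lintegral_add_left']
  · refine setLIntegral_congr_fun measurableSet_Ioo fun t ht => ?_
    exact ENNReal.ofReal_add (f0 t ht.1) (g0 t ht.1)
  · exact ((hf.mono fun t ht => ht.1).aemeasurable measurableSet_Ioo).ennreal_ofReal

theorem Lw_mul {f : ℝ → ℝ} {c : ℝ} (hc : 0 ≤ c) :
    Lw (fun t => c * f t) = ENNReal.ofReal c * Lw f := by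
  unfold Lw
  rw [← lintegral_const_mul' _ _ ENNReal.ofReal_ne_top]
  refine lintegral_congr fun t => ?_
  exact ENNReal.ofReal_mul hc

theorem wL2_sq_s5 (n : ℕ) (α : ℝ) (h : 2 * α = n) (w : ℝ → ℝ) :
    wL2 α w ^ 2 = Lw (fun s => s ^ n * w s ^ 2) := by
  unfold wL2 Lw
  rw [← ENNReal.rpow_natCast, ← ENNReal.rpow_mul]
  norm_num
  refine setLIntegral_congr_fun measurableSet_Ioo fun t ht => ?_
  simp only [h, Real.rpow_natCast]

theorem XnormSq_eq (m : ℕ) (u : ℝ → ℝ) : XnormSq m u =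
    ∑ n ∈ Finset.range (m + 1), Lw (fun s => s ^ (2 * n - m) * iteratedDeriv n u s ^ 2) := by
  unfold XnormSq
  obtain ⟨k, hk | hk⟩ := Nat.even_or_odd' m
  · rw [if_pos (by omega), show m / 2 = k by omega, show m + 1 = (k + 1) + k by omega,
      Finset.sum_range_add _ (k + 1) k]
    congr 1
    · refine Finset.sum_congr rfl fun i hi => ?_
      rw [Finset.mem_range] at hi
      rw [show 2 * i - m = 0 by omega]
      exact wL2_sq_s5 0 0 (by simp) _
    · refine Finset.sum_congr rfl fun i hi => ?_
      rw [show 2 * (k + 1 + i) - m = 2 * i + 2 by omega, show k + 1 + i = k + i + 1 by omega]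
      exact wL2_sq_s5 _ _ (by push_cast; ring) _
  · rw [if_neg (by omega), show m / 2 = k by omega, show m + 1 = (k + 1) + (k + 1) by omega,
      Finset.sum_range_add _ (k + 1) (k + 1)]
    congr 1
    · refine Finset.sum_congr rfl fun i hi => ?_
      rw [Finset.mem_range] at hi
      rw [show 2 * i - m = 0 by omega]
      exact wL2_sq_s5 0 0 (by simp) _
    · refine Finset.sum_congr rfl fun i hi => ?_
      rw [show 2 * (k + 1 + i) - m = 2 * i + 1 by omega, show k + 1 + i = k + i + 1 by omega]
      exact wL2_sq_s5 _ _ (by push_cast; ring) _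

theorem sup_bd {u : ℝ → ℝ} (hu : ContinuousOn u (Set.Ioi 0)) (h : wLinf 0 u ≠ ⊤) :
    ∀ t ∈ Set.Ioc (0:ℝ) 1, |u t| ≤ (wLinf 0 u).toReal := by
  have h1 : ∀ t ∈ Set.Ioo (0:ℝ) 1, |u t| ≤ (wLinf 0 u).toReal := by
    intro t ht
    have := le_iSup (fun s : Set.Ioo (0:ℝ) 1 => ENNReal.ofReal ((s : ℝ) ^ (0:ℝ) * ‖u (s : ℝ)‖)) ⟨t, ht⟩
    simp only [Real.rpow_zero, one_mul, Real.norm_eq_abs] at this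
    rw [← ENNReal.ofReal_le_iff_le_toReal h]
    refine this.trans_eq ?_
    simp [wLinf]
  intro t ht
  rcases lt_or_eq_of_le ht.2 with h2 | h2
  · exact h1 t ⟨ht.1, h2⟩
  · subst h2
    have c : ContinuousAt (fun t => |u t|) 1 := (hu.continuousAt (Ioi_mem_nhds one_pos)).abs
    have c2 : Filter.Tendsto (fun t => |u t|) (nhdsWithin 1 (Set.Iio 1)) (nhds |u 1|) :=
      c.tendsto.mono_left nhdsWithin_le_nhds
    refine le_of_tendsto c2 ?_
    filter_upwards [Ioo_mem_nhdsLT (zero_lt_one' ℝ)] with x hx using h1 x hx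

/-- tame product estimate
`‖uv‖_{X^m} ≤ C (‖u‖_{L^∞} ‖v‖_{X^m} + ‖v‖_{L^∞} ‖u‖_{X^m})`. -/
theorem stmt5 (m : ℕ) :
    ∃ C : ℝ, 0 < C ∧ ∀ u v : ℝ → ℝ,
      ContDiffOn ℝ (⊤ : ℕ∞) u (Set.Ioi 0) → ContDiffOn ℝ (⊤ : ℕ∞) v (Set.Ioi 0) →
      wLinf 0 u ≠ ⊤ → wLinf 0 v ≠ ⊤ → Xnorm m u ≠ ⊤ → Xnorm m v ≠ ⊤ →
      Xnorm m (fun s => u s * v s) ≤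
        ENNReal.ofReal C * (wLinf 0 u * Xnorm m v + wLinf 0 v * Xnorm m u) := by
  obtain ⟨C, hC, hA⟩ := assem m
  obtain ⟨K, hK⟩ : ∃ K : ℝ, K = (m + 1) * (C * 2) + 1 := ⟨_, rfl⟩
  have hK0 : 0 < K := by rw [hK]; positivity
  refine ⟨K ^ ((1:ℝ)/2), by positivity, ?_⟩
  intro u v hu hv hUt hVt _ _
  have hp := towerOf hu
  have hq := towerOf hv
  have hr := towerOf (hu.mul hv)
  have bu := sup_bd hu.continuousOn hUt
  have bv := sup_bd hv.continuousOn hVt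
  obtain ⟨U, hU⟩ : ∃ U, U = (wLinf 0 u).toReal := ⟨_, rfl⟩
  obtain ⟨V, hV⟩ : ∃ V, V = (wLinf 0 v).toReal := ⟨_, rfl⟩
  have hU0 : 0 ≤ U := by rw [hU]; exact ENNReal.toReal_nonneg
  have hV0 : 0 ≤ V := by rw [hV]; exact ENNReal.toReal_nonneg
  have eU : wLinf 0 u = ENNReal.ofReal U := by rw [hU, ENNReal.ofReal_toReal hUt]
  have eV : wLinf 0 v = ENNReal.ofReal V := by rw [hV, ENNReal.ofReal_toReal hVt]
  rw [← hU] at bu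
  rw [← hV] at bv
  have hass := hA _ _ _ hp hq hr
    (by
      intro t ht
      have c1 : ContDiffAt ℝ m u t := (hu.contDiffAt (Ioi_mem_nhds ht)).of_le (by exact_mod_cast le_top)
      have c2 : ContDiffAt ℝ m v t := (hv.contDiffAt (Ioi_mem_nhds ht)).of_le (by exact_mod_cast le_top)
      exact iteratedDeriv_fun_mul c1 c2)
    (by intro t ht; simp) U V hU0 hV0 (by simpa using bu) (by simpa using bv)
  -- energies are controlled by the norm
  have nn : ∀ (w : ℝ → ℝ) (a b : ℕ) (t : ℝ), 0 < t → 0 ≤ t ^ a * iteratedDeriv b w t ^ 2 :=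
    fun w a b t ht => by positivity
  have nn0 : ∀ (w : ℝ → ℝ) (b : ℕ) (t : ℝ), 0 < t → 0 ≤ iteratedDeriv b w t ^ 2 :=
    fun w b t ht => by positivity
  have enL : ∀ w : ℝ → ℝ, ContDiffOn ℝ (⊤ : ℕ∞) w (Set.Ioi 0) →
      Lw (fun t => t ^ m * iteratedDeriv m w t ^ 2 + iteratedDeriv 0 w t ^ 2) ≤ 2 * XnormSq m w := by
    intro w hw
    have hT := towerOf hw
    have cm := hT.contOn m
    rw [Lw_add (f := fun t => t ^ m * iteratedDeriv m w t ^ 2) (by fun_prop) (nn w m m) (nn0 w 0),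
      two_mul, XnormSq_eq]
    refine add_le_add ?_ ?_
    · have := Finset.single_le_sum (s := Finset.range (m + 1))
        (f := fun n => Lw (fun s => s ^ (2 * n - m) * iteratedDeriv n w s ^ 2))
        (fun _ _ => zero_le) (Finset.mem_range.2 (Nat.lt_succ_self m))
      simpa [show 2 * m - m = m by omega] using this
    · have := Finset.single_le_sum (s := Finset.range (m + 1))
        (f := fun n => Lw (fun s => s ^ (2 * n - m) * iteratedDeriv n w s ^ 2))
        (fun _ _ => zero_le) (Finset.mem_range.2 (Nat.succ_pos m))
      simpa using this
  have cu := hp.contE m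
  have cv := hq.contE m
  have each : ∀ n ∈ Finset.range (m + 1),
      Lw (fun s => s ^ (2 * n - m) * iteratedDeriv n (fun s => u s * v s) s ^ 2) ≤
      ENNReal.ofReal C * (ENNReal.ofReal (V ^ 2) * (2 * XnormSq m u) +
        ENNReal.ofReal (U ^ 2) * (2 * XnormSq m v)) := by
    intro n hn
    rw [Finset.mem_range] at hn
    have cr := hr.contOn n
    have := transfer (f := fun s => s ^ (2 * n - m) * iteratedDeriv n (fun s => u s * v s) s ^ 2)
      (g := fun t => C * (V ^ 2 * (t ^ m * iteratedDeriv m u t ^ 2 + iteratedDeriv 0 u t ^ 2) +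
        U ^ 2 * (t ^ m * iteratedDeriv m v t ^ 2 + iteratedDeriv 0 v t ^ 2)))
      ((continuousOn_id.pow _).mul (cr.pow 2))
      (continuousOn_const.mul ((continuousOn_const.mul cu).add (continuousOn_const.mul cv)))
      (nn _ _ _) (fun t ht => by positivity)
      (fun δ hδ hδ2 => by
        rw [intervalIntegral.integral_const_mul, hsum hp hq U V hδ (by linarith)]
        exact hass δ hδ hδ2 n hn)
    refine (show Lw _ ≤ Lw _ from this).trans ?_
    rw [Lw_mul hC, Lw_add (f := fun t => V ^ 2 *
      (t ^ m * iteratedDeriv m u t ^ 2 + iteratedDeriv 0 u t ^ 2)) (continuousOn_const.mul cu)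
      (fun t ht => by positivity) (fun t ht => by positivity), Lw_mul (by positivity),
      Lw_mul (by positivity)]
    gcongr
    · exact enL u hu
    · exact enL v hv
  have tot : XnormSq m (fun s => u s * v s) ≤ ENNReal.ofReal K *
      (ENNReal.ofReal (U ^ 2) * XnormSq m v + ENNReal.ofReal (V ^ 2) * XnormSq m u) := by
    rw [XnormSq_eq]
    refine (Finset.sum_le_card_nsmul _ _ _ each).trans ?_
    rw [Finset.card_range, nsmul_eq_mul]
    calc _ = ENNReal.ofReal ((m + 1) * (C * 2)) *
      (ENNReal.ofReal (U ^ 2) * XnormSq m v + ENNReal.ofReal (V ^ 2) * XnormSq m u) := by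
          rw [ENNReal.ofReal_mul (by positivity), ENNReal.ofReal_mul hC,
            ENNReal.ofReal_add (by positivity) one_pos.le]
          simp
          ring
      _ ≤ _ := by
          gcongr
          rw [hK]
          linarith
  have half : (0:ℝ) ≤ 1 / 2 := by norm_num
  have sqh : ∀ W : ℝ, 0 ≤ W → ENNReal.ofReal (W ^ 2) ^ ((1:ℝ)/2) = ENNReal.ofReal W := by
    intro W hW
    rw [ENNReal.ofReal_rpow_of_nonneg (by positivity) half, ← Real.sqrt_eq_rpow, Real.sqrt_sq hW]
  unfold Xnorm
  refine (ENNReal.rpow_le_rpow tot half).trans ?_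
  rw [ENNReal.mul_rpow_of_nonneg _ _ half, ENNReal.ofReal_rpow_of_nonneg hK0.le half]
  gcongr
  refine (ENNReal.rpow_add_le_add_rpow _ _ half (by norm_num)).trans_eq ?_
  rw [ENNReal.mul_rpow_of_nonneg _ _ half, ENNReal.mul_rpow_of_nonneg _ _ half, sqh U hU0, sqh V hV0,
    eU, eV]
end
end
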